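/- arXiv:1810.02088 — 7 statements merged into one kernel-verified Lean document; each statement's English description precedes it below -/
import Mathlib

section
/- (Theorem 3.1) Assume that for Lebesgue-a.e. x ∈ ℝ^n, 0 < ∫_ℝ f(x − μ) dμ < ∞ and ∫_ℝ |μ| f(x − μ) dμ < ∞, and that R₀ := ∫_{ℝ^n} μ̂₀(x)² f(x) dx < ∞, where μ̂₀(x) = (∫_ℝ μ f(x − μ) dμ)/(∫_ℝ f(x − μ) dμ) is the Pitman location estimator. Then μ̂₀ is minimax under squared error loss: ∫_{ℝ^n} (μ̂₀(x) − μ)² f(x − μ) dx = R₀ for every μ ∈ ℝ, and for every measurable estimator δ : ℝ^n → ℝ, sup_{μ ∈ ℝ} ∫_{ℝ^n} (δ(x) − μ)² f(x − μ) dx ≥ R₀. -/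
open MeasureTheory ENNReal

/-- The Pitman location estimator. -/
noncomputable def pitmanLoc (n : ℕ) (f : (Fin n → ℝ) → ℝ) (x : Fin n → ℝ) : ℝ :=
  (∫ μ : ℝ, μ * f (fun i => x i - μ)) / (∫ μ : ℝ, f (fun i => x i - μ))

open Filter Topology

theorem pitmanLoc_add_const {n : ℕ} {g : (Fin n → ℝ) → ℝ} {x : Fin n → ℝ}
    (h₀ : Integrable (fun μ : ℝ => g (fun i => x i - μ)))
    (h₁ : Integrable (fun μ : ℝ => μ * g (fun i => x i - μ)))
    (hpos : (∫ μ : ℝ, g (fun i => x i - μ)) ≠ 0) (c : ℝ) :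
    pitmanLoc n g (fun i => x i + c) = pitmanLoc n g x + c := by
  have hden : (∫ μ : ℝ, g (fun i => x i + c - μ)) = ∫ μ : ℝ, g (fun i => x i - μ) := by
    rw [← integral_add_right_eq_self (fun μ : ℝ => g (fun i => x i + c - μ)) c]
    simp only [add_sub_add_right_eq_sub]
  have hnum : (∫ μ : ℝ, μ * g (fun i => x i + c - μ))
      = (∫ μ : ℝ, μ * g (fun i => x i - μ)) + c * ∫ μ : ℝ, g (fun i => x i - μ) := by
    rw [← integral_add_right_eq_self (fun μ : ℝ => μ * g (fun i => x i + c - μ)) c,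
      ← integral_const_mul, ← integral_add h₁ (h₀.const_mul c)]
    simp only [add_sub_add_right_eq_sub, add_mul]
  unfold pitmanLoc
  rw [hden, hnum]
  field_simp

theorem measurable_comp_sub_const {n : ℕ} {g : (Fin n → ℝ) → ℝ} (hg : Measurable g) :
    Measurable (fun p : (Fin n → ℝ) × ℝ => g (fun i => p.1 i - p.2)) :=
  hg.comp (by fun_prop)

theorem measurable_pitmanLoc {n : ℕ} {g : (Fin n → ℝ) → ℝ} (hg : Measurable g) :
    Measurable (pitmanLoc n g) := by
  have hs := measurable_comp_sub_const hg
  have hnum : StronglyMeasurable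
      (fun x : Fin n → ℝ => ∫ μ : ℝ, μ * g (fun i => x i - μ)) :=
    StronglyMeasurable.integral_prod_right'
      (f := fun p : (Fin n → ℝ) × ℝ => p.2 * g (fun i => p.1 i - p.2))
      (measurable_snd.mul hs).stronglyMeasurable
  have hden : StronglyMeasurable (fun x : Fin n → ℝ => ∫ μ : ℝ, g (fun i => x i - μ)) :=
    StronglyMeasurable.integral_prod_right'
      (f := fun p : (Fin n → ℝ) × ℝ => g (fun i => p.1 i - p.2)) hs.stronglyMeasurable
  exact hnum.measurable.div hden.measurable

/-- The weighted mean minimizes the weighted sum of squared deviations. -/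
theorem lintegral_sq_mean_sub_le {w : ℝ → ℝ} (hw : ∀ μ, 0 ≤ w μ) (h₀ : Integrable w)
    (h₁ : Integrable (fun μ => μ * w μ)) (a : ℝ) :
    ∫⁻ μ, ENNReal.ofReal (((∫ t, t * w t) / (∫ t, w t) - μ) ^ 2 * w μ)
      ≤ ∫⁻ μ, ENNReal.ofReal ((a - μ) ^ 2 * w μ) := by
  set m : ℝ := (∫ t, t * w t) / (∫ t, w t) with hm
  by_cases hfin : ∫⁻ μ, ENNReal.ofReal ((a - μ) ^ 2 * w μ) = ⊤
  · rw [hfin]; exact le_top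
  have hmeas : AEStronglyMeasurable (fun μ => (a - μ) ^ 2 * w μ) := by
    have h : AEStronglyMeasurable (fun μ : ℝ => (a - μ) ^ 2) := by
      exact Continuous.aestronglyMeasurable (by fun_prop)
    exact h.mul h₀.aestronglyMeasurable
  have hnn : ∀ b : ℝ, 0 ≤ᵐ[volume] fun μ => (b - μ) ^ 2 * w μ :=
    fun b => Eventually.of_forall fun μ => mul_nonneg (sq_nonneg _) (hw μ)
  have ha : Integrable (fun μ => (a - μ) ^ 2 * w μ) :=
    (lintegral_ofReal_ne_top_iff_integrable hmeas (hnn a)).1 hfin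
  have hexp : (fun μ => (m - μ) ^ 2 * w μ) = fun μ =>
      ((a - μ) ^ 2 * w μ + (m ^ 2 - a ^ 2) * w μ) + 2 * (a - m) * (μ * w μ) := by
    ext μ; ring
  have hi₁ := ha.add (h₀.const_mul (m ^ 2 - a ^ 2))
  have hi₂ := h₁.const_mul (2 * (a - m))
  have hmi : Integrable (fun μ => (m - μ) ^ 2 * w μ) := by
    rw [hexp]; exact hi₁.add hi₂
  rw [← ofReal_integral_eq_lintegral_ofReal hmi (hnn m),
    ← ofReal_integral_eq_lintegral_ofReal ha (hnn a)]
  apply ENNReal.ofReal_le_ofReal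
  have hmean : (∫ t, t * w t) = m * ∫ t, w t := by
    by_cases h : (∫ t, w t) = 0
    · have hz := (integral_eq_zero_iff_of_nonneg hw h₀).1 h
      have : (∫ t, t * w t) = 0 := by
        apply integral_eq_zero_of_ae
        filter_upwards [hz] with t ht
        simp [ht]
      rw [this, h, mul_zero]
    · rw [hm, div_mul_cancel₀ _ h]
  have hsum : (∫ μ, (m - μ) ^ 2 * w μ)
      = (∫ μ, (a - μ) ^ 2 * w μ) + (m ^ 2 - a ^ 2) * (∫ μ, w μ)
        + 2 * (a - m) * ∫ μ, μ * w μ := by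
    rw [hexp, integral_add (by exact hi₁) hi₂, integral_add ha (h₀.const_mul _),
      integral_const_mul, integral_const_mul]
  rw [hsum, hmean]
  have hw_int : 0 ≤ ∫ μ, w μ := integral_nonneg hw
  nlinarith [mul_nonneg (sq_nonneg (a - m)) hw_int]

/-- The restriction of `f` to the slab `|x i₀| ≤ L`. -/
noncomputable def slabTrunc {n : ℕ} (f : (Fin n → ℝ) → ℝ) (i₀ : Fin n) (L : ℝ) :
    (Fin n → ℝ) → ℝ :=
  {x | |x i₀| ≤ L}.indicator f

section slabTrunc

variable {n : ℕ} {f : (Fin n → ℝ) → ℝ} {i₀ : Fin n} {L : ℝ}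

theorem measurable_slabTrunc (hf : Measurable f) : Measurable (slabTrunc f i₀ L) :=
  hf.indicator (measurableSet_le (by fun_prop) measurable_const)

theorem slabTrunc_nonneg (hf : ∀ x, 0 ≤ f x) (x : Fin n → ℝ) : 0 ≤ slabTrunc f i₀ L x :=
  Set.indicator_nonneg (fun x _ => hf x) x

theorem slabTrunc_le (hf : ∀ x, 0 ≤ f x) (x : Fin n → ℝ) : slabTrunc f i₀ L x ≤ f x :=
  Set.indicator_le_self' (fun x _ => hf x) x

theorem tendsto_slabTrunc (x : Fin n → ℝ) :
    Tendsto (fun L => slabTrunc f i₀ L x) atTop (𝓝 (f x)) := by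
  refine tendsto_const_nhds.congr' ?_
  filter_upwards [eventually_ge_atTop |x i₀|] with L hL
  exact (Set.indicator_of_mem (s := {x : Fin n → ℝ | |x i₀| ≤ L}) hL f).symm

theorem integrable_slabTrunc (hfm : Measurable f) (hf : ∀ x, 0 ≤ f x) {x : Fin n → ℝ}
    (h : Integrable (fun μ : ℝ => f (fun i => x i - μ))) :
    Integrable (fun μ : ℝ => slabTrunc f i₀ L (fun i => x i - μ)) := by
  refine h.mono' ?_ (Eventually.of_forall fun μ => ?_)
  · exact ((measurable_slabTrunc hfm).comp (by fun_prop)).aestronglyMeasurable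
  · rw [Real.norm_of_nonneg (slabTrunc_nonneg hf _)]
    exact slabTrunc_le hf _

theorem norm_mul_slabTrunc_le (hf : ∀ x, 0 ≤ f x) (μ : ℝ) (x : Fin n → ℝ) :
    ‖μ * slabTrunc f i₀ L x‖ ≤ |μ| * f x := by
  rw [norm_mul, Real.norm_eq_abs, Real.norm_of_nonneg (slabTrunc_nonneg hf _)]
  exact mul_le_mul_of_nonneg_left (slabTrunc_le hf _) (abs_nonneg _)

theorem integrable_mul_slabTrunc (hfm : Measurable f) (hf : ∀ x, 0 ≤ f x) {x : Fin n → ℝ}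
    (h : Integrable (fun μ : ℝ => |μ| * f (fun i => x i - μ))) :
    Integrable (fun μ : ℝ => μ * slabTrunc f i₀ L (fun i => x i - μ)) := by
  refine h.mono' ?_ (Eventually.of_forall fun μ => norm_mul_slabTrunc_le hf _ _)
  exact (measurable_id.mul
    ((measurable_slabTrunc hfm).comp (by fun_prop))).aestronglyMeasurable

theorem tendsto_pitmanLoc_slabTrunc (hfm : Measurable f) (hf : ∀ x, 0 ≤ f x) {x : Fin n → ℝ}
    (h₀ : Integrable (fun μ : ℝ => f (fun i => x i - μ)))
    (hpos : (∫ μ : ℝ, f (fun i => x i - μ)) ≠ 0)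
    (h₁ : Integrable (fun μ : ℝ => |μ| * f (fun i => x i - μ))) :
    Tendsto (fun L => pitmanLoc n (slabTrunc f i₀ L) x) atTop (𝓝 (pitmanLoc n f x)) := by
  refine Tendsto.div ?_ ?_ hpos
  · refine tendsto_integral_filter_of_dominated_convergence _ (Eventually.of_forall fun L => ?_)
      (Eventually.of_forall fun L => Eventually.of_forall fun μ => norm_mul_slabTrunc_le hf _ _)
      h₁ (Eventually.of_forall fun μ => (tendsto_slabTrunc _).const_mul μ)
    exact (integrable_mul_slabTrunc hfm hf h₁).aestronglyMeasurable
  · refine tendsto_integral_filter_of_dominated_convergence _ (Eventually.of_forall fun L => ?_)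
      (Eventually.of_forall fun L => Eventually.of_forall fun μ => ?_)
      h₀ (Eventually.of_forall fun μ => tendsto_slabTrunc _)
    · exact (integrable_slabTrunc hfm hf h₀).aestronglyMeasurable
    · rw [Real.norm_of_nonneg (slabTrunc_nonneg hf _)]
      exact slabTrunc_le hf _

/-- The risk at `0` of the Pitman estimator of the truncated density is bounded by the average
over `|μ| ≤ K + L` of the risk of an arbitrary estimator. -/
theorem ofReal_mul_lintegral_pitmanLoc_slabTrunc_le (hfm : Measurable f) (hf : ∀ x, 0 ≤ f x)
    (hae : ∀ᵐ x : Fin n → ℝ,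
      Integrable (fun μ : ℝ => f (fun i => x i - μ)) ∧
      Integrable (fun μ : ℝ => |μ| * f (fun i => x i - μ)))
    {δ : (Fin n → ℝ) → ℝ} (hδ : Measurable δ) (K : ℝ) :
    ENNReal.ofReal (2 * K) *
        ∫⁻ x, ENNReal.ofReal (pitmanLoc n (slabTrunc f i₀ L) x ^ 2 * slabTrunc f i₀ L x)
      ≤ ENNReal.ofReal (2 * (K + L)) *
        ⨆ μ : ℝ, ∫⁻ x, ENNReal.ofReal ((δ x - μ) ^ 2 * f (fun i => x i - μ)) := by
  set g := slabTrunc f i₀ L with hg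
  have hgm : Measurable g := measurable_slabTrunc hfm
  have hg0 : ∀ x, 0 ≤ g x := slabTrunc_nonneg hf
  have hpm : Measurable (pitmanLoc n g) := measurable_pitmanLoc hgm
  have hgs := measurable_comp_sub_const hgm
  have hvol : ∀ a r : ℝ, volume {μ : ℝ | |a + μ| ≤ r} = ENNReal.ofReal (2 * r) := by
    intro a r
    have : {μ : ℝ | |a + μ| ≤ r} = Set.Icc (-a - r) (-a + r) := by
      ext μ
      simp only [Set.mem_ofPred_eq, Set.mem_Icc, abs_le]
      constructor <;> rintro ⟨h, h'⟩ <;> constructor <;> linarith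
    rw [this, Real.volume_Icc]
    congr 1; ring
  have hsK : MeasurableSet {x : Fin n → ℝ | |x i₀| ≤ K} :=
    measurableSet_le (by fun_prop) measurable_const
  have hsK' : ∀ a r : ℝ, MeasurableSet {μ : ℝ | |a + μ| ≤ r} := fun a r =>
    measurableSet_le (by fun_prop) measurable_const
  have hjoint : ∀ d : (Fin n → ℝ) → ℝ, Measurable d →
      Measurable (fun p : (Fin n → ℝ) × ℝ =>
        {x : Fin n → ℝ | |x i₀| ≤ K}.indicator (fun x =>
          ENNReal.ofReal ((d x - p.2) ^ 2 * g (fun i => x i - p.2))) p.1) := by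
    intro d hd
    have h : Measurable (fun p : (Fin n → ℝ) × ℝ =>
        ENNReal.ofReal ((d p.1 - p.2) ^ 2 * g (fun i => p.1 i - p.2))) :=
      ((((hd.comp measurable_fst).sub measurable_snd).pow_const 2).mul hgs).ennreal_ofReal
    exact h.indicator (measurable_fst hsK)
  calc ENNReal.ofReal (2 * K) * ∫⁻ x, ENNReal.ofReal (pitmanLoc n g x ^ 2 * g x)
      = ∫⁻ x, ∫⁻ μ : ℝ, {μ : ℝ | |x i₀ + μ| ≤ K}.indicator
          (fun _ => ENNReal.ofReal (pitmanLoc n g x ^ 2 * g x)) μ := by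
        rw [← lintegral_const_mul' _ _ ENNReal.ofReal_ne_top]
        refine lintegral_congr fun x => ?_
        rw [lintegral_indicator_const (hsK' _ _), hvol, mul_comm]
    _ ≤ ∫⁻ x, ∫⁻ μ : ℝ, {x : Fin n → ℝ | |x i₀| ≤ K}.indicator (fun y =>
          ENNReal.ofReal ((pitmanLoc n g y - μ) ^ 2 * g (fun i => y i - μ)))
            (x + fun _ => μ) := by
        refine lintegral_mono_ae ?_
        filter_upwards [hae] with x hx
        refine lintegral_mono fun μ => ?_
        by_cases hxK : |x i₀ + μ| ≤ K
        · rw [Set.indicator_of_mem (s := {μ : ℝ | |x i₀ + μ| ≤ K}) hxK,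
            Set.indicator_of_mem (s := {x : Fin n → ℝ | |x i₀| ≤ K}) hxK]
          apply ENNReal.ofReal_le_ofReal
          simp only [Pi.add_apply, add_sub_cancel_right]
          refine mul_le_mul_of_nonneg_right ?_ (hg0 x)
          by_cases hD : (∫ μ : ℝ, g (fun i => x i - μ)) = 0
          · have : pitmanLoc n g x = 0 := by rw [pitmanLoc, hD, _root_.div_zero]
            rw [this, zero_pow two_ne_zero]
            exact sq_nonneg _
          · have h := pitmanLoc_add_const (integrable_slabTrunc hfm hf hx.1)
              (integrable_mul_slabTrunc hfm hf hx.2) hD μ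
            have h' : (x + fun _ => μ) = fun i => x i + μ := rfl
            rw [h', h, add_sub_cancel_right]
        · rw [Set.indicator_of_notMem (s := {μ : ℝ | |x i₀ + μ| ≤ K}) hxK]
          exact zero_le
    _ = ∫⁻ μ : ℝ, ∫⁻ x, {x : Fin n → ℝ | |x i₀| ≤ K}.indicator (fun y =>
          ENNReal.ofReal ((pitmanLoc n g y - μ) ^ 2 * g (fun i => y i - μ)))
            (x + fun _ => μ) := by
        refine lintegral_lintegral_swap (Measurable.aemeasurable ?_)
        have hshift : Measurable (fun p : (Fin n → ℝ) × ℝ => (p.1 + (fun _ => p.2), p.2)) := by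
          fun_prop
        exact (hjoint _ hpm).comp hshift
    _ = ∫⁻ μ : ℝ, ∫⁻ x, {x : Fin n → ℝ | |x i₀| ≤ K}.indicator (fun y =>
          ENNReal.ofReal ((pitmanLoc n g y - μ) ^ 2 * g (fun i => y i - μ))) x := by
        refine lintegral_congr fun μ => ?_
        exact lintegral_add_right_eq_self _ _
    _ = ∫⁻ x, ∫⁻ μ : ℝ, {x : Fin n → ℝ | |x i₀| ≤ K}.indicator (fun y =>
          ENNReal.ofReal ((pitmanLoc n g y - μ) ^ 2 * g (fun i => y i - μ))) x :=
        (lintegral_lintegral_swap (hjoint _ hpm).aemeasurable).symm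
    _ ≤ ∫⁻ x, ∫⁻ μ : ℝ, {x : Fin n → ℝ | |x i₀| ≤ K}.indicator (fun y =>
          ENNReal.ofReal ((δ y - μ) ^ 2 * g (fun i => y i - μ))) x := by
        refine lintegral_mono_ae ?_
        filter_upwards [hae] with x hx
        by_cases hxK : x ∈ {x : Fin n → ℝ | |x i₀| ≤ K}
        · simp only [Set.indicator_of_mem hxK]
          exact lintegral_sq_mean_sub_le (fun μ => hg0 _) (integrable_slabTrunc hfm hf hx.1)
            (integrable_mul_slabTrunc hfm hf hx.2) (δ x)
        · simp only [Set.indicator_of_notMem hxK, le_refl]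
    _ = ∫⁻ μ : ℝ, ∫⁻ x, {x : Fin n → ℝ | |x i₀| ≤ K}.indicator (fun y =>
          ENNReal.ofReal ((δ y - μ) ^ 2 * g (fun i => y i - μ))) x :=
        lintegral_lintegral_swap (hjoint _ hδ).aemeasurable
    _ ≤ ∫⁻ μ : ℝ, {μ : ℝ | |0 + μ| ≤ K + L}.indicator (fun _ =>
          ⨆ μ : ℝ, ∫⁻ x, ENNReal.ofReal ((δ x - μ) ^ 2 * f (fun i => x i - μ))) μ := by
        refine lintegral_mono fun μ => ?_
        by_cases hμ : |0 + μ| ≤ K + L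
        · rw [Set.indicator_of_mem (s := {μ : ℝ | |0 + μ| ≤ K + L}) hμ]
          refine le_trans (lintegral_mono fun x => ?_) (le_iSup (fun μ : ℝ =>
            ∫⁻ x, ENNReal.ofReal ((δ x - μ) ^ 2 * f (fun i => x i - μ))) μ)
          refine (Set.indicator_le_self' (fun _ _ => zero_le) x).trans ?_
          exact ENNReal.ofReal_le_ofReal
            (mul_le_mul_of_nonneg_left (slabTrunc_le hf _) (sq_nonneg _))
        · rw [Set.indicator_of_notMem (s := {μ : ℝ | |0 + μ| ≤ K + L}) hμ]
          refine le_of_eq (lintegral_eq_zero_of_ae_eq_zero (Eventually.of_forall fun x => ?_))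
          by_cases hxK : |x i₀| ≤ K
          · have hL : ¬ |x i₀ - μ| ≤ L := by
              intro h
              apply hμ
              rw [zero_add]
              calc |μ| = |x i₀ - (x i₀ - μ)| := by congr 1; ring
                _ ≤ |x i₀| + |x i₀ - μ| := abs_sub _ _
                _ ≤ K + L := add_le_add hxK h
            have hz : g (fun i => x i - μ) = 0 :=
              Set.indicator_of_notMem (s := {x : Fin n → ℝ | |x i₀| ≤ L}) hL f
            rw [Set.indicator_of_mem (s := {x : Fin n → ℝ | |x i₀| ≤ K}) hxK, hz]
            simp
          · exact Set.indicator_of_notMem (s := {x : Fin n → ℝ | |x i₀| ≤ K}) hxK _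
    _ = ENNReal.ofReal (2 * (K + L)) *
        ⨆ μ : ℝ, ∫⁻ x, ENNReal.ofReal ((δ x - μ) ^ 2 * f (fun i => x i - μ)) := by
        rw [lintegral_indicator_const (hsK' _ _), hvol, mul_comm]

end slabTrunc

/-- (Theorem 3.1) The Pitman location estimator is minimax under squared error loss:
its risk is constant, equal to `R₀`, and every measurable estimator has supremum risk
at least `R₀`. -/
theorem pitmanLoc_minimax
    (n : ℕ) (f : (Fin n → ℝ) → ℝ) (hfm : Measurable f) (hf0 : ∀ x, 0 ≤ f x)
    (hf1 : ∫ x, f x = 1)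
    (hae : ∀ᵐ x : Fin n → ℝ,
      Integrable (fun μ : ℝ => f (fun i => x i - μ)) ∧
      0 < (∫ μ : ℝ, f (fun i => x i - μ)) ∧
      Integrable (fun μ : ℝ => |μ| * f (fun i => x i - μ)))
    (R₀ : ℝ≥0∞)
    (hR₀ : R₀ = ∫⁻ x, ENNReal.ofReal ((pitmanLoc n f x) ^ 2 * f x))
    (hR₀fin : R₀ < ⊤) :
    (∀ μ : ℝ,
      ∫⁻ x, ENNReal.ofReal ((pitmanLoc n f x - μ) ^ 2 * f (fun i => x i - μ)) = R₀) ∧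
    (∀ δ : (Fin n → ℝ) → ℝ, Measurable δ →
      R₀ ≤ ⨆ μ : ℝ, ∫⁻ x, ENNReal.ofReal ((δ x - μ) ^ 2 * f (fun i => x i - μ))) := by
  have hidx : Nonempty (Fin n) := by
    rcases Nat.eq_zero_or_pos n with rfl | hn
    · obtain ⟨x, -, hx, -⟩ := hae.exists
      have hconst : ∀ μ : ℝ, f (fun i => x i - μ) = f x :=
        fun μ => congrArg f (Subsingleton.elim _ _)
      simp [hconst, Measure.real] at hx
    · exact ⟨⟨0, hn⟩⟩
  obtain ⟨i₀⟩ := hidx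
  constructor
  · intro μ
    rw [hR₀, ← lintegral_add_right_eq_self _ (fun _ : Fin n => μ)]
    refine lintegral_congr_ae ?_
    filter_upwards [hae] with x ⟨h₀, hpos, h₁⟩
    have h₁' : Integrable (fun t : ℝ => t * f (fun i => x i - t)) := by
      refine h₁.mono' (measurable_id.mul (hfm.comp (by fun_prop))).aestronglyMeasurable
        (Eventually.of_forall fun t => ?_)
      rw [norm_mul, Real.norm_eq_abs, Real.norm_of_nonneg (hf0 _)]
    have h := pitmanLoc_add_const h₀ h₁' hpos.ne' μ
    have hx : (x + fun _ => μ) = fun i => x i + μ := rfl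
    simp only [hx, h, add_sub_cancel_right]
  · intro δ hδ
    have hae' : ∀ᵐ x : Fin n → ℝ,
        Integrable (fun μ : ℝ => f (fun i => x i - μ)) ∧
        Integrable (fun μ : ℝ => |μ| * f (fun i => x i - μ)) :=
      hae.mono fun x hx => ⟨hx.1, hx.2.2⟩
    set S := ⨆ μ : ℝ, ∫⁻ x, ENNReal.ofReal ((δ x - μ) ^ 2 * f (fun i => x i - μ))
    have hbound : ∀ j : ℕ, ∫⁻ x, ENNReal.ofReal
        (pitmanLoc n (slabTrunc f i₀ (j + 1)) x ^ 2 * slabTrunc f i₀ (j + 1) x)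
        ≤ ENNReal.ofReal (1 + 1 / ((j : ℝ) + 1)) * S := by
      intro j
      have hj : (0 : ℝ) < (j : ℝ) + 1 := by positivity
      have hK : (0 : ℝ) < 2 * ((j : ℝ) + 1) ^ 2 := by positivity
      have h := ofReal_mul_lintegral_pitmanLoc_slabTrunc_le (i₀ := i₀) (L := (j : ℝ) + 1)
        hfm hf0 hae' hδ (((j : ℝ) + 1) ^ 2)
      have hsplit : 2 * (((j : ℝ) + 1) ^ 2 + ((j : ℝ) + 1))
          = 2 * ((j : ℝ) + 1) ^ 2 * (1 + 1 / ((j : ℝ) + 1)) := by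
        field_simp
      rw [hsplit, ENNReal.ofReal_mul hK.le, mul_assoc] at h
      exact (ENNReal.mul_le_mul_iff_right (ENNReal.ofReal_pos.2 hK).ne'
        ENNReal.ofReal_ne_top).1 h
    have hlim : Tendsto (fun j : ℕ => ENNReal.ofReal (1 + 1 / ((j : ℝ) + 1)) * S) atTop (𝓝 S) := by
      have h : Tendsto (fun j : ℕ => 1 + 1 / ((j : ℝ) + 1)) atTop (𝓝 1) := by
        simpa using (tendsto_one_div_add_atTop_nhds_zero_nat (𝕜 := ℝ)).const_add 1
      have h' := ENNReal.Tendsto.mul_const (b := S) (ENNReal.tendsto_ofReal h) (Or.inl (by simp))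
      simpa using h'
    have htop : Tendsto (fun j : ℕ => (j : ℝ) + 1) atTop atTop :=
      tendsto_atTop_add_const_right _ _ tendsto_natCast_atTop_atTop
    calc R₀ = ∫⁻ x, liminf (fun j : ℕ => ENNReal.ofReal
          (pitmanLoc n (slabTrunc f i₀ (j + 1)) x ^ 2 * slabTrunc f i₀ (j + 1) x)) atTop := by
          rw [hR₀]
          refine lintegral_congr_ae ?_
          filter_upwards [hae] with x ⟨h₀, hpos, h₁⟩
          refine (Tendsto.liminf_eq ?_).symm
          exact ENNReal.tendsto_ofReal
            ((((tendsto_pitmanLoc_slabTrunc hfm hf0 h₀ hpos.ne' h₁).comp htop).pow 2).mul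
              ((tendsto_slabTrunc x).comp htop))
      _ ≤ liminf (fun j : ℕ => ∫⁻ x, ENNReal.ofReal
          (pitmanLoc n (slabTrunc f i₀ (j + 1)) x ^ 2 * slabTrunc f i₀ (j + 1) x)) atTop :=
          lintegral_liminf_le fun j =>
            (((measurable_pitmanLoc (measurable_slabTrunc hfm)).pow_const 2).mul
              (measurable_slabTrunc hfm)).ennreal_ofReal
      _ ≤ liminf (fun j : ℕ => ENNReal.ofReal (1 + 1 / ((j : ℝ) + 1)) * S) atTop :=
          liminf_le_liminf (Eventually.of_forall hbound)
      _ = S := hlim.liminf_eq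
end

section
/- Fix z ∈ ℝ^n and μ ∈ ℝ, and assume 0 < ∫_ℝ f(z − t) dt < ∞ and ∫_ℝ |t| f(z − t) dt < ∞. For each k ≥ 1 define δ*_k(z, kμ) = (∫_ℝ t f(z − t) φ(t/k + μ) dt)/(∫_ℝ f(z − t) φ(t/k + μ) dt). Then lim_{k→∞} δ*_k(z, kμ) = μ̂₀(z) = (∫_ℝ t f(z − t) dt)/(∫_ℝ f(z − t) dt). -/
open MeasureTheory ENNReal Filter Topology

/-- The standard normal density. -/
noncomputable def stdNormal (t : ℝ) : ℝ :=
  Real.exp (-(t ^ 2) / 2) / Real.sqrt (2 * Real.pi)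

theorem stdNormal_pos (t : ℝ) : 0 < stdNormal t := by
  unfold stdNormal
  positivity

theorem continuous_stdNormal : Continuous stdNormal := by
  unfold stdNormal
  fun_prop

theorem stdNormal_le (t : ℝ) : stdNormal t ≤ 1 / Real.sqrt (2 * Real.pi) := by
  unfold stdNormal
  gcongr
  exact Real.exp_le_one_iff.mpr (by nlinarith [sq_nonneg t])

/-- Integrating against an increasingly dilated normal density becomes integrating against
a constant weight. -/
theorem tendsto_integral_mul_stdNormal {g : ℝ → ℝ} (hg : Integrable g) (μ : ℝ) :
    Tendsto (fun k : ℝ => ∫ t : ℝ, g t * stdNormal (t / k + μ)) atTop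
      (𝓝 ((∫ t : ℝ, g t) * stdNormal μ)) := by
  rw [← integral_mul_const]
  refine tendsto_integral_filter_of_dominated_convergence
    (fun t => ‖g t‖ * (1 / Real.sqrt (2 * Real.pi))) ?_ ?_ (hg.norm.mul_const _) ?_
  · refine .of_forall fun k => hg.aestronglyMeasurable.mul ?_
    exact (continuous_stdNormal.comp (by fun_prop)).aestronglyMeasurable
  · refine .of_forall fun k => .of_forall fun t => ?_
    rw [norm_mul, Real.norm_of_nonneg (stdNormal_pos _).le]
    exact mul_le_mul_of_nonneg_left (stdNormal_le _) (norm_nonneg _)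
  · refine .of_forall fun t => Tendsto.const_mul _ ?_
    have h : Tendsto (fun k : ℝ => t / k + μ) atTop (𝓝 μ) := by
      simpa using (tendsto_id.const_div_atTop t).add_const μ
    exact (continuous_stdNormal.tendsto μ).comp h

/-- The proxy Bayes estimators `δ*_k(z, kμ)` converge to the Pitman estimator
`μ̂₀(z)` as `k → ∞`. -/
theorem proxy_bayes_tendsto_pitman
    (n : ℕ) (f : (Fin n → ℝ) → ℝ) (hfm : Measurable f) (hf0 : ∀ x, 0 ≤ f x)
    (hf1 : ∫ x, f x = 1)
    (z : Fin n → ℝ) (μ : ℝ)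
    (h1 : Integrable (fun t : ℝ => f (fun i => z i - t)))
    (h2 : 0 < ∫ t : ℝ, f (fun i => z i - t))
    (h3 : Integrable (fun t : ℝ => |t| * f (fun i => z i - t))) :
    Tendsto (fun k : ℝ =>
        (∫ t : ℝ, t * f (fun i => z i - t) * stdNormal (t / k + μ)) /
        (∫ t : ℝ, f (fun i => z i - t) * stdNormal (t / k + μ)))
      atTop
      (𝓝 ((∫ t : ℝ, t * f (fun i => z i - t)) / (∫ t : ℝ, f (fun i => z i - t)))) := by
  have h4 : Integrable (fun t : ℝ => t * f (fun i => z i - t)) := by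
    refine h3.mono (aestronglyMeasurable_id.mul h1.aestronglyMeasurable) (.of_forall fun t => ?_)
    simp
  have h := (tendsto_integral_mul_stdNormal h4 μ).div (tendsto_integral_mul_stdNormal h1 μ)
    (mul_pos h2 (stdNormal_pos μ)).ne'
  rwa [mul_div_mul_right _ _ (stdNormal_pos μ).ne'] at h
end

section
/- (Multivariate location, Remark 3.1) Assume that for Lebesgue-a.e. x ∈ (ℝ^n)^p, 0 < ∫_{ℝ^p} f(x − μ) dμ < ∞ and ∫_{ℝ^p} ‖μ‖ f(x − μ) dμ < ∞, and that R₀ := ∫_{(ℝ^n)^p} ‖μ̂(x)‖² f(x) dx < ∞, where μ̂(x) = (∫_{ℝ^p} μ f(x − μ) dμ)/(∫_{ℝ^p} f(x − μ) dμ) ∈ ℝ^p is the multivariate Pitman estimator. Then μ̂ is minimax under quadratic loss: for every measurable estimator δ : (ℝ^n)^p → ℝ^p, sup_{μ ∈ ℝ^p} ∫_{(ℝ^n)^p} ‖δ(x) − μ‖² f(x − μ) dx ≥ R₀, and ∫ ‖μ̂(x) − μ‖² f(x − μ) dx = R₀ for every μ ∈ ℝ^p. -/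
open MeasureTheory ENNReal

/-- Coordinatewise translation: subtract `μ i` from every coordinate of `x i ∈ ℝ^n`. -/
def locShift (n p : ℕ) (x : Fin p → Fin n → ℝ) (μ : EuclideanSpace ℝ (Fin p)) :
    Fin p → Fin n → ℝ :=
  fun i j => x i j - μ i

/-- The multivariate Pitman location estimator. -/
noncomputable def pitmanLocVec (n p : ℕ) (f : (Fin p → Fin n → ℝ) → ℝ)
    (x : Fin p → Fin n → ℝ) : EuclideanSpace ℝ (Fin p) :=
  (∫ μ : EuclideanSpace ℝ (Fin p), f (locShift n p x μ))⁻¹ •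
    ∫ μ : EuclideanSpace ℝ (Fin p), f (locShift n p x μ) • μ

lemma memLp_two_sub_const_of_lintegral_lt_top {E : Type*} [NormedAddCommGroup E]
    [MeasurableSpace E] [BorelSpace E] [SecondCountableTopology E] {ρ : Measure E}
    [IsFiniteMeasure ρ] {a : E} (ha : ∫⁻ u, ‖u - a‖ₑ ^ 2 ∂ρ < ⊤) (v : E) :
    MemLp (fun u : E => u - v) 2 ρ := by
  have h : MemLp (fun u : E => u - a) 2 ρ := by
    refine ⟨by fun_prop, ?_⟩
    rw [eLpNorm_lt_top_iff_lintegral_rpow_enorm_lt_top (by simp) (by simp)]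
    simpa using ha
  have hv : (fun u : E => u - v) = (fun u => u - a) + fun _ => a - v := by
    ext u
    simp
  rw [hv]
  exact h.add (memLp_const _)

lemma lintegral_lintegral_enorm_sub_sq_add {E : Type*} [NormedAddCommGroup E]
    [InnerProductSpace ℝ E] [CompleteSpace E] [MeasurableSpace E] [BorelSpace E]
    [SecondCountableTopology E] (ρ : Measure E) [IsFiniteMeasure ρ] (a : E)
    (ha : ∫⁻ u, ‖u - a‖ₑ ^ 2 ∂ρ < ⊤) :
    ∫⁻ v, ∫⁻ u, ‖u - v‖ₑ ^ 2 ∂ρ ∂ρ + 2 * ‖∫ u, (u - a) ∂ρ‖ₑ ^ 2 =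
      2 * ρ Set.univ * ∫⁻ u, ‖u - a‖ₑ ^ 2 ∂ρ := by
  have hmem := memLp_two_sub_const_of_lintegral_lt_top ha
  have hsq : ∀ v : E, Integrable (fun u => ‖u - v‖ ^ 2) ρ := fun v =>
    (hmem v).integrable_norm_pow (by simp)
  have hint : ∀ v : E, Integrable (fun u => u - v) ρ := fun v => (hmem v).integrable (by simp)
  have hlin : ∀ v : E, ∫⁻ u, ‖u - v‖ₑ ^ 2 ∂ρ = ENNReal.ofReal (∫ u, ‖u - v‖ ^ 2 ∂ρ) := by
    intro v
    rw [ofReal_integral_eq_lintegral_ofReal (hsq v) (.of_forall fun u => by positivity)]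
    simp [ENNReal.ofReal_pow]
  set A := ∫ u, ‖u - a‖ ^ 2 ∂ρ with hA
  set b := ∫ u, (u - a) ∂ρ with hb
  have hexp : ∀ v : E, ∫ u, ‖u - v‖ ^ 2 ∂ρ =
      A - 2 * inner ℝ b (v - a) + ρ.real Set.univ * ‖v - a‖ ^ 2 := by
    intro v
    have h1 : ∀ u : E, ‖u - v‖ ^ 2 =
        ‖u - a‖ ^ 2 - 2 * inner ℝ (v - a) (u - a) + ‖v - a‖ ^ 2 := by
      intro u
      rw [← real_inner_comm, ← norm_sub_sq_real]
      simp
    have hi : Integrable (fun u => (inner ℝ (v - a) (u - a) : ℝ)) ρ := (hint a).const_inner _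
    simp_rw [h1]
    have hs : Integrable (fun u => ‖u - a‖ ^ 2 - 2 * (inner ℝ (v - a) (u - a) : ℝ)) ρ :=
      (hsq a).sub (hi.const_mul 2)
    rw [integral_add hs (integrable_const _), integral_sub (hsq a) (hi.const_mul 2),
      integral_const_mul, integral_inner (hint a), real_inner_comm]
    simp [hA, hb]
  have hi : Integrable (fun v => (inner ℝ b (v - a) : ℝ)) ρ := (hint a).const_inner _
  have hs : Integrable (fun v => A - 2 * (inner ℝ b (v - a) : ℝ)) ρ :=
    (integrable_const _).sub (hi.const_mul 2)
  have hI : Integrable (fun v => A - 2 * inner ℝ b (v - a) + ρ.real Set.univ * ‖v - a‖ ^ 2) ρ :=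
    hs.add ((hsq a).const_mul _)
  have hdouble : ∫ v, (A - 2 * inner ℝ b (v - a) + ρ.real Set.univ * ‖v - a‖ ^ 2) ∂ρ =
      2 * ρ.real Set.univ * A - 2 * ‖b‖ ^ 2 := by
    rw [integral_add hs ((hsq a).const_mul _),
      integral_sub (integrable_const _) (hi.const_mul 2), integral_const_mul,
      integral_inner (hint a), integral_const_mul, real_inner_self_eq_norm_sq]
    simp
    ring
  have hnn : ∀ v, 0 ≤ A - 2 * inner ℝ b (v - a) + ρ.real Set.univ * ‖v - a‖ ^ 2 := by
    intro v
    rw [← hexp]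
    positivity
  have hd0 : 0 ≤ 2 * ρ.real Set.univ * A - 2 * ‖b‖ ^ 2 := by
    rw [← hdouble]
    exact integral_nonneg hnn
  simp_rw [hlin, hexp]
  rw [← ofReal_integral_eq_lintegral_ofReal hI (.of_forall hnn), hdouble]
  have e1 : 2 * ‖b‖ₑ ^ 2 = ENNReal.ofReal (2 * ‖b‖ ^ 2) := by
    rw [ENNReal.ofReal_mul (by norm_num), ENNReal.ofReal_pow (by positivity)]
    simp
  have e2 : 2 * ρ Set.univ = ENNReal.ofReal (2 * ρ.real Set.univ) := by
    rw [ENNReal.ofReal_mul (by norm_num)]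
    simp
  rw [e1, e2, ← ENNReal.ofReal_add hd0 (by positivity), ← ENNReal.ofReal_mul (by positivity)]
  have e3 : A - 2 * inner ℝ b (a - a) + ρ.real Set.univ * ‖a - a‖ ^ 2 = A := by simp
  rw [e3]
  congr 1
  ring

lemma lintegral_lintegral_enorm_sub_sq_le {E : Type*} [NormedAddCommGroup E]
    [InnerProductSpace ℝ E] [CompleteSpace E] [MeasurableSpace E] [BorelSpace E]
    [SecondCountableTopology E] (ρ : Measure E) [IsFiniteMeasure ρ] (a : E) :
    ∫⁻ v, ∫⁻ u, ‖u - v‖ₑ ^ 2 ∂ρ ∂ρ ≤ 2 * ρ Set.univ * ∫⁻ u, ‖u - a‖ₑ ^ 2 ∂ρ := by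
  rcases eq_or_ne ρ 0 with rfl | hρ
  · simp
  rcases lt_or_ge (∫⁻ u, ‖u - a‖ₑ ^ 2 ∂ρ) ⊤ with h | h
  · rw [← lintegral_lintegral_enorm_sub_sq_add ρ a h]
    exact le_self_add
  · rw [top_le_iff.1 h, ENNReal.mul_top (by simpa using hρ)]
    exact le_top

lemma le_lintegral_lintegral_enorm_sub_sq {E : Type*} [NormedAddCommGroup E]
    [InnerProductSpace ℝ E] [CompleteSpace E] [MeasurableSpace E] [BorelSpace E]
    [SecondCountableTopology E] (ρ : Measure E) [IsFiniteMeasure ρ]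
    (hρ : Integrable (fun u => u) ρ) :
    2 * ρ Set.univ * ∫⁻ u, ‖u - (ρ.real Set.univ)⁻¹ • ∫ u, u ∂ρ‖ₑ ^ 2 ∂ρ ≤
      ∫⁻ v, ∫⁻ u, ‖u - v‖ₑ ^ 2 ∂ρ ∂ρ := by
  rcases eq_or_ne ρ 0 with rfl | h0
  · simp
  by_cases h : ∃ a, ∫⁻ u, ‖u - a‖ₑ ^ 2 ∂ρ < ⊤
  · obtain ⟨a, ha⟩ := h
    have hm : ∀ v : E, ∫⁻ u, ‖u - v‖ₑ ^ 2 ∂ρ < ⊤ := by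
      intro v
      have := (memLp_two_sub_const_of_lintegral_lt_top ha v).2
      rw [eLpNorm_lt_top_iff_lintegral_rpow_enorm_lt_top (by simp) (by simp)] at this
      simpa using this
    rw [← lintegral_lintegral_enorm_sub_sq_add ρ _ (hm _), integral_sub hρ (integrable_const _)]
    have : ρ.real Set.univ ≠ 0 := by
      rw [Measure.real, ENNReal.toReal_ne_zero]
      exact ⟨by simpa using h0, measure_ne_top _ _⟩
    simp [smul_smul, this]
  · push Not at h
    have : ∀ v : E, ∫⁻ u, ‖u - v‖ₑ ^ 2 ∂ρ = ⊤ := fun v => top_le_iff.1 (h v)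
    simp only [this, lintegral_const]
    rw [ENNReal.top_mul (by simpa using h0)]
    exact le_top

lemma locShift_locShift (n p : ℕ) (x : Fin p → Fin n → ℝ) (μ ν : EuclideanSpace ℝ (Fin p)) :
    locShift n p (locShift n p x μ) ν = locShift n p x (μ + ν) := by
  ext i j
  simp [locShift, sub_sub]

@[simp]
lemma locShift_zero (n p : ℕ) (x : Fin p → Fin n → ℝ) : locShift n p x 0 = x := by
  ext i j
  simp [locShift]

@[fun_prop]
lemma Measurable.locShift {α : Type*} [MeasurableSpace α] {n p : ℕ}
    {x : α → Fin p → Fin n → ℝ} {μ : α → EuclideanSpace ℝ (Fin p)}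
    (hx : Measurable x) (hμ : Measurable μ) : Measurable fun a => locShift n p (x a) (μ a) := by
  unfold _root_.locShift
  fun_prop

lemma lintegral_locShift (n p : ℕ) (h : (Fin p → Fin n → ℝ) → ℝ≥0∞)
    (μ : EuclideanSpace ℝ (Fin p)) : ∫⁻ x, h (locShift n p x μ) = ∫⁻ x, h x :=
  lintegral_sub_right_eq_self h fun i _ => μ i

/-- The total mass `∫ g (x - μ) dμ` of the location orbit through `x`. -/
noncomputable def locMass (n p : ℕ) (g : (Fin p → Fin n → ℝ) → ℝ≥0∞) (x : Fin p → Fin n → ℝ) :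
    ℝ≥0∞ :=
  ∫⁻ μ, g (locShift n p x μ)

/-- The integral of `‖u - v‖²` over pairs `u, v ∈ B` with weights `g (x - u)` and `g (x - v)`. -/
noncomputable def pairDispersion (n p : ℕ) (g : (Fin p → Fin n → ℝ) → ℝ≥0∞)
    (B : Set (EuclideanSpace ℝ (Fin p))) (x : Fin p → Fin n → ℝ) : ℝ≥0∞ :=
  ∫⁻ v in B, ∫⁻ u in B, ‖u - v‖ₑ ^ 2 * (g (locShift n p x u) * g (locShift n p x v))

section

variable {n p : ℕ} {g : (Fin p → Fin n → ℝ) → ℝ≥0∞}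

lemma locMass_locShift (x : Fin p → Fin n → ℝ) (ν : EuclideanSpace ℝ (Fin p)) :
    locMass n p g (locShift n p x ν) = locMass n p g x := by
  simp_rw [locMass, locShift_locShift]
  exact lintegral_add_left_eq_self (fun μ => g (locShift n p x μ)) ν

lemma locMass_eq_lintegral_neg (x : Fin p → Fin n → ℝ) :
    locMass n p g x = ∫⁻ μ, g (locShift n p x (-μ)) :=
  (lintegral_neg_eq_self (fun μ => g (locShift n p x μ))).symm

lemma measurable_locMass (hg : Measurable g) : Measurable (locMass n p g) := by
  unfold locMass
  exact Measurable.lintegral_prod_right (by fun_prop)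

lemma measurable_pairDispersion (hg : Measurable g) (B : Set (EuclideanSpace ℝ (Fin p))) :
    Measurable (pairDispersion n p g B) := by
  unfold pairDispersion
  have h : Measurable fun q : (Fin p → Fin n → ℝ) × EuclideanSpace ℝ (Fin p) => ∫⁻ u in B,
      ‖u - q.2‖ₑ ^ 2 * (g (locShift n p q.1 u) * g (locShift n p q.1 q.2)) :=
    Measurable.lintegral_prod_right (by fun_prop)
  exact h.lintegral_prod_right'

lemma pairDispersion_mono {B C : Set (EuclideanSpace ℝ (Fin p))} (h : B ⊆ C)
    (x : Fin p → Fin n → ℝ) : pairDispersion n p g B x ≤ pairDispersion n p g C x :=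
  (lintegral_mono_set h).trans (lintegral_mono fun _ => lintegral_mono_set h)

lemma pairDispersion_eq (hg : Measurable g) (B : Set (EuclideanSpace ℝ (Fin p)))
    (x : Fin p → Fin n → ℝ) :
    pairDispersion n p g B x =
      ∫⁻ v, ∫⁻ u, ‖u - v‖ₑ ^ 2 ∂(volume.restrict B).withDensity (fun μ => g (locShift n p x μ))
        ∂(volume.restrict B).withDensity (fun μ => g (locShift n p x μ)) := by
  have hw : Measurable fun μ => g (locShift n p x μ) := by fun_prop
  have hin : ∀ v : EuclideanSpace ℝ (Fin p),
      ∫⁻ u, ‖u - v‖ₑ ^ 2 ∂(volume.restrict B).withDensity (fun μ => g (locShift n p x μ)) =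
        ∫⁻ u in B, g (locShift n p x u) * ‖u - v‖ₑ ^ 2 := by
    intro v
    rw [lintegral_withDensity_eq_lintegral_mul _ hw (by fun_prop)]
    rfl
  simp_rw [hin]
  rw [lintegral_withDensity_eq_lintegral_mul _ hw
    (Measurable.lintegral_prod_right (by fun_prop))]
  refine lintegral_congr fun v => ?_
  rw [Pi.mul_apply, ← lintegral_const_mul _ (by fun_prop)]
  refine lintegral_congr fun u => ?_
  ring

lemma pairDispersion_le_mul (hg : Measurable g) (B : Set (EuclideanSpace ℝ (Fin p)))
    {x : Fin p → Fin n → ℝ} (hx : locMass n p g x ≠ ⊤)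
    (a : EuclideanSpace ℝ (Fin p)) :
    pairDispersion n p g B x ≤
      2 * locMass n p g x * ∫⁻ μ in B, ‖a - μ‖ₑ ^ 2 * g (locShift n p x μ) := by
  have hw : Measurable fun μ => g (locShift n p x μ) := by fun_prop
  have hle : ∫⁻ μ in B, g (locShift n p x μ) ≤ locMass n p g x := setLIntegral_le_lintegral _ _
  have := isFiniteMeasure_withDensity (ne_top_of_le_ne_top hx hle)
  rw [pairDispersion_eq hg]
  refine (lintegral_lintegral_enorm_sub_sq_le _ a).trans ?_
  rw [lintegral_withDensity_eq_lintegral_mul _ hw (by fun_prop)]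
  simp only [withDensity_apply _ MeasurableSet.univ, Measure.restrict_univ]
  gcongr with u
  rw [Pi.mul_apply, mul_comm, ← enorm_neg, neg_sub]

lemma pairDispersion_le_locShift {B C : Set (EuclideanSpace ℝ (Fin p))}
    {ν : EuclideanSpace ℝ (Fin p)} (h : ∀ u ∈ C, u - ν ∈ B) (x : Fin p → Fin n → ℝ) :
    pairDispersion n p g C x ≤ pairDispersion n p g B (locShift n p x ν) := by
  have hset : ∀ F : EuclideanSpace ℝ (Fin p) → ℝ≥0∞,
      ∫⁻ u in B, F (ν + u) = ∫⁻ u in (fun u => u - ν) ⁻¹' B, F u := by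
    intro F
    rw [← (measurePreserving_sub_right volume ν).setLIntegral_comp_preimage_emb
      (measurableEmbedding_subRight ν)]
    simp
  have hpair : ∀ v u : EuclideanSpace ℝ (Fin p), u - v = (ν + u) - (ν + v) := by
    intro v u
    abel
  have : pairDispersion n p g B (locShift n p x ν) =
      pairDispersion n p g ((fun u => u - ν) ⁻¹' B) x := by
    unfold pairDispersion
    simp_rw [locShift_locShift]
    rw [← hset]
    refine lintegral_congr fun v => ?_
    rw [← hset]
    refine lintegral_congr fun u => ?_
    rw [hpair]
  rw [this]
  exact pairDispersion_mono h x

lemma lintegral_pairDispersion_le (hg : Measurable g)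
    (hmass : ∀ᵐ x, locMass n p g x ≠ 0 ∧ locMass n p g x ≠ ⊤)
    {δ : (Fin p → Fin n → ℝ) → EuclideanSpace ℝ (Fin p)} (hδ : Measurable δ)
    (B : Set (EuclideanSpace ℝ (Fin p))) :
    ∫⁻ x, pairDispersion n p g B x * (2 * locMass n p g x)⁻¹ ≤
      (⨆ μ, ∫⁻ x, ‖δ x - μ‖ₑ ^ 2 * g (locShift n p x μ)) * volume B := by
  calc ∫⁻ x, pairDispersion n p g B x * (2 * locMass n p g x)⁻¹
      ≤ ∫⁻ x, ∫⁻ μ in B, ‖δ x - μ‖ₑ ^ 2 * g (locShift n p x μ) := by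
        refine lintegral_mono_ae ?_
        filter_upwards [hmass] with x hx
        rw [← div_eq_mul_inv]
        refine ENNReal.div_le_of_le_mul' ?_
        exact pairDispersion_le_mul hg B hx.2 _
    _ = ∫⁻ μ in B, ∫⁻ x, ‖δ x - μ‖ₑ ^ 2 * g (locShift n p x μ) :=
        lintegral_lintegral_swap (by fun_prop)
    _ ≤ ∫⁻ μ in B, ⨆ μ, ∫⁻ x, ‖δ x - μ‖ₑ ^ 2 * g (locShift n p x μ) :=
        lintegral_mono fun μ => le_iSup (fun μ => ∫⁻ x, ‖δ x - μ‖ₑ ^ 2 * g (locShift n p x μ)) μ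
    _ = _ := by simp

lemma mul_lintegral_pairDispersion_le (hg : Measurable g)
    (hmass : ∀ᵐ x, locMass n p g x ≠ 0 ∧ locMass n p g x ≠ ⊤)
    {A B C : Set (EuclideanSpace ℝ (Fin p))} (hA : MeasurableSet A)
    (h : ∀ ν ∈ A, ∀ u ∈ C, u + ν ∈ B) :
    volume A * ∫⁻ y, g y * (pairDispersion n p g C y * (2 * locMass n p g y)⁻¹ *
        (locMass n p g y)⁻¹) ≤
      ∫⁻ x, pairDispersion n p g B x * (2 * locMass n p g x)⁻¹ := by
  have hZ := measurable_locMass hg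
  have hK := measurable_pairDispersion hg B
  set Φ : (Fin p → Fin n → ℝ) → ℝ≥0∞ := fun x =>
    pairDispersion n p g B x * (2 * locMass n p g x)⁻¹ * (locMass n p g x)⁻¹ with hΦ
  have hΦm : Measurable Φ := by fun_prop
  calc _ = ∫⁻ ν in A, ∫⁻ y, g y * (pairDispersion n p g C y * (2 * locMass n p g y)⁻¹ *
        (locMass n p g y)⁻¹) := by simp [mul_comm]
    _ ≤ ∫⁻ ν in A, ∫⁻ y, g y * Φ (locShift n p y (-ν)) := by
        refine setLIntegral_mono' hA fun ν hν => lintegral_mono fun y => ?_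
        simp only [hΦ, locMass_locShift]
        gcongr
        exact pairDispersion_le_locShift (fun u hu => by simpa using h ν hν u hu) y
    _ ≤ ∫⁻ ν, ∫⁻ y, g y * Φ (locShift n p y (-ν)) := setLIntegral_le_lintegral _ _
    _ = ∫⁻ ν, ∫⁻ x, g (locShift n p x ν) * Φ x := by
        refine lintegral_congr fun ν => ?_
        rw [← lintegral_locShift n p (fun y => g y * Φ (locShift n p y (-ν))) ν]
        simp [locShift_locShift]
    _ = ∫⁻ x, ∫⁻ ν, g (locShift n p x ν) * Φ x := lintegral_lintegral_swap (by fun_prop)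
    _ = ∫⁻ x, locMass n p g x * Φ x := by
        refine lintegral_congr fun x => ?_
        rw [lintegral_mul_const _ (by fun_prop), locMass]
    _ = _ := by
        refine lintegral_congr_ae ?_
        filter_upwards [hmass] with x hx
        rw [hΦ, mul_comm, mul_assoc, ENNReal.inv_mul_cancel hx.1 hx.2, mul_one]

lemma lintegral_pairDispersion_ball_le_iSup (hg : Measurable g)
    (hmass : ∀ᵐ x, locMass n p g x ≠ 0 ∧ locMass n p g x ≠ ⊤)
    {δ : (Fin p → Fin n → ℝ) → EuclideanSpace ℝ (Fin p)} (hδ : Measurable δ) (k : ℕ) :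
    ∫⁻ y, g y * (pairDispersion n p g (Metric.ball 0 k) y * (2 * locMass n p g y)⁻¹ *
        (locMass n p g y)⁻¹) ≤
      ⨆ μ, ∫⁻ x, ‖δ x - μ‖ₑ ^ 2 * g (locShift n p x μ) := by
  set T := ∫⁻ y, g y * (pairDispersion n p g (Metric.ball 0 k) y * (2 * locMass n p g y)⁻¹ *
        (locMass n p g y)⁻¹)
  set S := ⨆ μ, ∫⁻ x, ‖δ x - μ‖ₑ ^ 2 * g (locShift n p x μ)
  have hbound : ∀ m : ℕ, 0 < m → ENNReal.ofReal (((m : ℝ) / (m + k)) ^ p) * T ≤ S := by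
    intro m hm
    have hm' : (0 : ℝ) < m := by exact_mod_cast hm
    have hmk : (0 : ℝ) < m + k := by positivity
    have h := (mul_lintegral_pairDispersion_le hg hmass
      (A := Metric.ball (0 : EuclideanSpace ℝ (Fin p)) m) (B := Metric.ball 0 (m + k))
      (C := Metric.ball 0 k) measurableSet_ball (by
        intro ν hν u hu
        rw [mem_ball_zero_iff] at *
        linarith [norm_add_le u ν])).trans (lintegral_pairDispersion_le hg hmass hδ _)
    rw [Measure.addHaar_ball_of_pos _ _ hm', Measure.addHaar_ball_of_pos _ _ hmk,
      finrank_euclideanSpace_fin] at h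
    set c := volume (Metric.ball (0 : EuclideanSpace ℝ (Fin p)) 1)
    have hc0 : c ≠ 0 := (Metric.measure_ball_pos _ _ one_pos).ne'
    have hc : c ≠ ⊤ := measure_ball_lt_top.ne
    have h2 : ENNReal.ofReal ((m : ℝ) ^ p) * T ≤ S * ENNReal.ofReal ((m + k : ℝ) ^ p) := by
      rw [← ENNReal.mul_le_mul_iff_left hc0 hc]
      calc _ = ENNReal.ofReal ((m : ℝ) ^ p) * c * T := by ring
        _ ≤ _ := h
        _ = _ := by ring
    rw [div_pow, ENNReal.ofReal_div_of_pos (by positivity), mul_comm, ← mul_div_assoc,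
      mul_comm T]
    exact ENNReal.div_le_of_le_mul h2
  have hlim : Filter.Tendsto (fun m : ℕ => ENNReal.ofReal (((m : ℝ) / (m + k)) ^ p) * T)
      Filter.atTop (nhds (ENNReal.ofReal (1 ^ p) * T)) :=
    ENNReal.Tendsto.mul_const
      (ENNReal.tendsto_ofReal ((tendsto_natCast_div_add_atTop (k : ℝ)).pow p)) (by simp)
  rw [one_pow, ENNReal.ofReal_one, one_mul] at hlim
  exact le_of_tendsto hlim ((Filter.eventually_gt_atTop 0).mono hbound)

lemma pairDispersion_eq_setLIntegral_prod (hg : Measurable g)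
    (B : Set (EuclideanSpace ℝ (Fin p))) (x : Fin p → Fin n → ℝ) :
    pairDispersion n p g B x = ∫⁻ z in B ×ˢ B,
      ‖z.2 - z.1‖ₑ ^ 2 * (g (locShift n p x z.2) * g (locShift n p x z.1)) := by
  rw [Measure.volume_eq_prod, ← Measure.prod_restrict, lintegral_prod _ (by fun_prop)]
  rfl

lemma iSup_pairDispersion_ball (hg : Measurable g) (x : Fin p → Fin n → ℝ) :
    ⨆ k : ℕ, pairDispersion n p g (Metric.ball 0 k) x = pairDispersion n p g Set.univ x := by
  have hmono : Monotone fun k : ℕ => Metric.ball (0 : EuclideanSpace ℝ (Fin p)) (k : ℝ) :=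
    fun k l hkl => Metric.ball_subset_ball (by exact_mod_cast hkl)
  have hU : ⋃ k : ℕ, (Metric.ball 0 (k : ℝ) ×ˢ Metric.ball 0 (k : ℝ) :
      Set (EuclideanSpace ℝ (Fin p) × EuclideanSpace ℝ (Fin p))) = Set.univ ×ˢ Set.univ := by
    rw [Set.iUnion_prod_of_monotone hmono hmono, Metric.iUnion_ball_nat]
  simp_rw [pairDispersion_eq_setLIntegral_prod hg]
  rw [← hU, setLIntegral_iUnion_of_directed]
  exact Monotone.directed_le fun k l hkl => Set.prod_mono (hmono hkl) (hmono hkl)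

lemma lintegral_pairDispersion_univ_le_iSup (hg : Measurable g)
    (hmass : ∀ᵐ x, locMass n p g x ≠ 0 ∧ locMass n p g x ≠ ⊤)
    {δ : (Fin p → Fin n → ℝ) → EuclideanSpace ℝ (Fin p)} (hδ : Measurable δ) :
    ∫⁻ y, g y * (pairDispersion n p g Set.univ y * (2 * locMass n p g y)⁻¹ *
        (locMass n p g y)⁻¹) ≤
      ⨆ μ, ∫⁻ x, ‖δ x - μ‖ₑ ^ 2 * g (locShift n p x μ) := by
  have hZ := measurable_locMass hg
  have hK := fun k : ℕ => measurable_pairDispersion hg (Metric.ball 0 k)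
  simp_rw [← iSup_pairDispersion_ball hg, ENNReal.iSup_mul, ENNReal.mul_iSup]
  rw [lintegral_iSup (by fun_prop)]
  · exact iSup_le fun k => lintegral_pairDispersion_ball_le_iSup hg hmass hδ k
  · intro k l hkl y
    dsimp only
    gcongr
    exact pairDispersion_mono (Metric.ball_subset_ball (by exact_mod_cast hkl)) y

lemma lintegral_enorm_sq_mul_le_pairDispersion (hg : Measurable g)
    (hmass : ∀ᵐ x, locMass n p g x ≠ 0 ∧ locMass n p g x ≠ ⊤)
    {m : (Fin p → Fin n → ℝ) → EuclideanSpace ℝ (Fin p)} (hm : Measurable m)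
    (hequiv : ∀ᵐ x, ∀ μ, m (locShift n p x μ) = m x - μ)
    (hvar : ∀ᵐ x, 2 * locMass n p g x * ∫⁻ μ, ‖m x - μ‖ₑ ^ 2 * g (locShift n p x μ) ≤
      pairDispersion n p g Set.univ x) :
    ∫⁻ x, ‖m x‖ₑ ^ 2 * g x ≤
      ∫⁻ y, g y * (pairDispersion n p g Set.univ y * (2 * locMass n p g y)⁻¹ *
        (locMass n p g y)⁻¹) := by
  have hZ := measurable_locMass hg
  calc ∫⁻ x, ‖m x‖ₑ ^ 2 * g x
      = ∫⁻ x, ∫⁻ μ, ‖m x‖ₑ ^ 2 * g x * (locMass n p g x)⁻¹ * g (locShift n p x (-μ)) := by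
        refine lintegral_congr_ae ?_
        filter_upwards [hmass] with x hx
        rw [lintegral_const_mul _ (by fun_prop), ← locMass_eq_lintegral_neg, mul_assoc,
          ENNReal.inv_mul_cancel hx.1 hx.2, mul_one]
    _ = ∫⁻ μ, ∫⁻ x, ‖m x‖ₑ ^ 2 * g x * (locMass n p g x)⁻¹ * g (locShift n p x (-μ)) :=
        lintegral_lintegral_swap (by fun_prop)
    _ = ∫⁻ μ, ∫⁻ y, g y * (locMass n p g y)⁻¹ * (‖m y - μ‖ₑ ^ 2 * g (locShift n p y μ)) := by
        refine lintegral_congr fun μ => ?_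
        rw [← lintegral_locShift n p _ μ]
        refine lintegral_congr_ae ?_
        filter_upwards [hequiv] with y hy
        rw [hy, locMass_locShift, locShift_locShift, add_neg_cancel, locShift_zero]
        ring
    _ = ∫⁻ y, ∫⁻ μ, g y * (locMass n p g y)⁻¹ * (‖m y - μ‖ₑ ^ 2 * g (locShift n p y μ)) :=
        (lintegral_lintegral_swap (by fun_prop)).symm
    _ ≤ _ := by
        refine lintegral_mono_ae ?_
        filter_upwards [hmass, hvar] with y hy hv
        rw [lintegral_const_mul _ (by fun_prop), mul_assoc, mul_comm (locMass n p g y)⁻¹]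
        gcongr
        rw [← div_eq_mul_inv, ENNReal.le_div_iff_mul_le (by simp [hy.1])
          (by simp [ENNReal.mul_eq_top, hy.2]), mul_comm]
        exact hv

lemma measurable_pitmanLocVec {f : (Fin p → Fin n → ℝ) → ℝ} (hf : Measurable f) :
    Measurable (pitmanLocVec n p f) := by
  have h1 : StronglyMeasurable fun x : Fin p → Fin n → ℝ =>
      ∫ μ : EuclideanSpace ℝ (Fin p), f (locShift n p x μ) :=
    StronglyMeasurable.integral_prod_right
      (f := fun x (μ : EuclideanSpace ℝ (Fin p)) => f (locShift n p x μ))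
      (Measurable.stronglyMeasurable (by simp only [Function.uncurry_def]; fun_prop))
  have h2 : StronglyMeasurable fun x : Fin p → Fin n → ℝ =>
      ∫ μ : EuclideanSpace ℝ (Fin p), f (locShift n p x μ) • μ :=
    StronglyMeasurable.integral_prod_right
      (f := fun x (μ : EuclideanSpace ℝ (Fin p)) => f (locShift n p x μ) • μ)
      (Measurable.stronglyMeasurable (by simp only [Function.uncurry_def]; fun_prop))
  exact h1.measurable.inv.smul h2.measurable

lemma integrable_smul_of_integrable_norm_mul {f : (Fin p → Fin n → ℝ) → ℝ} (hf : Measurable f)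
    {x : Fin p → Fin n → ℝ}
    (hx : Integrable fun μ : EuclideanSpace ℝ (Fin p) => ‖μ‖ * f (locShift n p x μ)) :
    Integrable fun μ : EuclideanSpace ℝ (Fin p) => f (locShift n p x μ) • μ := by
  refine hx.mono (Measurable.aestronglyMeasurable (by fun_prop)) (.of_forall fun μ => ?_)
  simp [norm_smul, mul_comm]

lemma pitmanLocVec_locShift {f : (Fin p → Fin n → ℝ) → ℝ} (hf : Measurable f)
    {x : Fin p → Fin n → ℝ}
    (h0 : Integrable fun μ : EuclideanSpace ℝ (Fin p) => f (locShift n p x μ))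
    (hpos : 0 < ∫ μ : EuclideanSpace ℝ (Fin p), f (locShift n p x μ))
    (h1 : Integrable fun μ : EuclideanSpace ℝ (Fin p) => ‖μ‖ * f (locShift n p x μ))
    (ν : EuclideanSpace ℝ (Fin p)) :
    pitmanLocVec n p f (locShift n p x ν) = pitmanLocVec n p f x - ν := by
  have hs := integrable_smul_of_integrable_norm_mul hf h1
  unfold pitmanLocVec
  simp_rw [locShift_locShift]
  have e0 := integral_add_left_eq_self (μ := volume) (fun μ => f (locShift n p x μ)) ν
  have e1 := integral_add_left_eq_self (μ := volume) (fun μ => f (locShift n p x μ) • (μ - ν)) ν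
  simp only [add_sub_cancel_left] at e1
  rw [e0, e1]
  simp_rw [smul_sub]
  rw [integral_sub hs (h0.smul_const ν), integral_smul_const, smul_sub, smul_smul,
    inv_mul_cancel₀ hpos.ne', one_smul]

lemma mul_lintegral_enorm_pitmanLocVec_sub_le {f : (Fin p → Fin n → ℝ) → ℝ} (hf : Measurable f)
    (hf0 : ∀ x, 0 ≤ f x) {x : Fin p → Fin n → ℝ}
    (hfin : locMass n p (fun x => ENNReal.ofReal (f x)) x ≠ ⊤)
    (h1 : Integrable fun μ : EuclideanSpace ℝ (Fin p) => ‖μ‖ * f (locShift n p x μ)) :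
    2 * locMass n p (fun x => ENNReal.ofReal (f x)) x *
        ∫⁻ μ, ‖pitmanLocVec n p f x - μ‖ₑ ^ 2 * ENNReal.ofReal (f (locShift n p x μ)) ≤
      pairDispersion n p (fun x => ENNReal.ofReal (f x)) Set.univ x := by
  have hw : Measurable fun μ => ENNReal.ofReal (f (locShift n p x μ)) := by fun_prop
  have := isFiniteMeasure_withDensity hfin
  have hs := integrable_smul_of_integrable_norm_mul hf h1
  set ρ := volume.withDensity fun μ => ENNReal.ofReal (f (locShift n p x μ)) with hρ
  have hI : Integrable (fun u => u) ρ := by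
    rw [hρ, integrable_withDensity_iff_integrable_smul' hw (by simp)]
    simpa [ENNReal.toReal_ofReal (hf0 _)] using hs
  have hmass : ρ Set.univ = locMass n p (fun x => ENNReal.ofReal (f x)) x := by
    simp [hρ, locMass]
  have hmean : (ρ.real Set.univ)⁻¹ • ∫ u, u ∂ρ = pitmanLocVec n p f x := by
    rw [pitmanLocVec, hρ, integral_withDensity_eq_integral_toReal_smul hw (by simp), ← hρ,
      Measure.real, hmass, locMass,
      integral_eq_lintegral_of_nonneg_ae (.of_forall fun _ => hf0 _)
        (Measurable.aestronglyMeasurable (by fun_prop))]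
    simp [ENNReal.toReal_ofReal (hf0 _)]
  have h := le_lintegral_lintegral_enorm_sub_sq ρ hI
  rw [pairDispersion_eq (by fun_prop), Measure.restrict_univ, ← hmass]
  refine le_trans (le_of_eq ?_) h
  rw [hmean]
  congr 1
  rw [hρ, lintegral_withDensity_eq_lintegral_mul _ hw (by fun_prop)]
  refine lintegral_congr fun u => ?_
  rw [Pi.mul_apply, mul_comm, ← enorm_neg, neg_sub]

end

/-- (Remark 3.1) The multivariate Pitman estimator is minimax under quadratic loss:
its risk is constant, equal to `R₀`, and every measurable estimator has supremum risk
at least `R₀`. -/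
theorem pitmanLocVec_minimax
    (n p : ℕ) (f : (Fin p → Fin n → ℝ) → ℝ)
    (hfm : Measurable f) (hf0 : ∀ x, 0 ≤ f x) (hf1 : ∫ x, f x = 1)
    (hae : ∀ᵐ x : Fin p → Fin n → ℝ,
      Integrable (fun μ : EuclideanSpace ℝ (Fin p) => f (locShift n p x μ)) ∧
      0 < (∫ μ : EuclideanSpace ℝ (Fin p), f (locShift n p x μ)) ∧
      Integrable (fun μ : EuclideanSpace ℝ (Fin p) => ‖μ‖ * f (locShift n p x μ)))
    (R₀ : ℝ≥0∞)
    (hR₀ : R₀ = ∫⁻ x, ENNReal.ofReal (‖pitmanLocVec n p f x‖ ^ 2 * f x))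
    (hR₀fin : R₀ < ⊤) :
    (∀ δ : (Fin p → Fin n → ℝ) → EuclideanSpace ℝ (Fin p), Measurable δ →
      R₀ ≤ ⨆ μ : EuclideanSpace ℝ (Fin p),
        ∫⁻ x, ENNReal.ofReal (‖δ x - μ‖ ^ 2 * f (locShift n p x μ))) ∧
    (∀ μ : EuclideanSpace ℝ (Fin p),
      ∫⁻ x, ENNReal.ofReal (‖pitmanLocVec n p f x - μ‖ ^ 2 * f (locShift n p x μ)) = R₀) := by
  set g : (Fin p → Fin n → ℝ) → ℝ≥0∞ := fun x => ENNReal.ofReal (f x)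
  have hg : Measurable g := by fun_prop
  have hrisk : ∀ (v : EuclideanSpace ℝ (Fin p)) (y : Fin p → Fin n → ℝ),
      ENNReal.ofReal (‖v‖ ^ 2 * f y) = ‖v‖ₑ ^ 2 * g y := by
    intro v y
    rw [ENNReal.ofReal_mul (by positivity), ENNReal.ofReal_pow (by positivity), ofReal_norm]
  simp only [hrisk] at hR₀ ⊢
  have hmass : ∀ᵐ x, locMass n p g x ≠ 0 ∧ locMass n p g x ≠ ⊤ := by
    filter_upwards [hae] with x ⟨h0, hpos, _⟩
    rw [locMass, ← ofReal_integral_eq_lintegral_ofReal h0 (.of_forall fun _ => hf0 _)]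
    exact ⟨by simpa using hpos, ENNReal.ofReal_ne_top⟩
  have hequiv : ∀ᵐ x, ∀ μ, pitmanLocVec n p f (locShift n p x μ) = pitmanLocVec n p f x - μ := by
    filter_upwards [hae] with x ⟨h0, hpos, h1⟩
    exact pitmanLocVec_locShift hfm h0 hpos h1
  refine ⟨fun δ hδ => ?_, fun μ => ?_⟩
  · rw [hR₀]
    refine (lintegral_enorm_sq_mul_le_pairDispersion hg hmass (measurable_pitmanLocVec hfm) hequiv
      ?_).trans (lintegral_pairDispersion_univ_le_iSup hg hmass hδ)
    filter_upwards [hae, hmass] with x ⟨_, _, h1⟩ hx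
    exact mul_lintegral_enorm_pitmanLocVec_sub_le hfm hf0 hx.2 h1
  · rw [hR₀, ← lintegral_locShift n p (fun x => ‖pitmanLocVec n p f x‖ₑ ^ 2 * g x) μ]
    refine lintegral_congr_ae ?_
    filter_upwards [hequiv] with x hx
    rw [hx]
end

section
/- (Theorem 2.2) Suppose δ₀ : ℝ^n → ℝ is measurable and scale equivariant, and for every x ∈ ℝ^n it minimizes the posterior loss under the prior π(σ) = 1/σ: for all d ∈ ℝ, ∫_0^∞ L(δ₀(x)/σ) σ^{−n−1} f(x/σ) dσ ≤ ∫_0^∞ L(d/σ) σ^{−n−1} f(x/σ) dσ. Then δ₀ is best equivariant: for every measurable scale-equivariant estimator δ : ℝ^n → ℝ and every σ > 0, R(δ₀, σ) ≤ R(δ, σ). -/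
open MeasureTheory ENNReal

/-- Change of variables `x ↦ s⁻¹ • x` in a Lebesgue integral on `ℝⁿ`. -/
theorem lintegral_inv_smul_fin {n : ℕ} {h : (Fin n → ℝ) → ℝ≥0∞} (hh : Measurable h)
    {s : ℝ} (hs : 0 < s) :
    ∫⁻ x, h (s⁻¹ • x) = ENNReal.ofReal (s ^ n) * ∫⁻ x, h x := by
  have hmap := Measure.map_addHaar_smul (volume : Measure (Fin n → ℝ)) (inv_ne_zero hs.ne')
  rw [← lintegral_map hh (measurable_const_smul s⁻¹), hmap, lintegral_smul_measure, smul_eq_mul]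
  congr 2
  rw [Module.finrank_fin_fun, inv_pow, inv_inv, abs_of_pos (pow_pos hs n)]

/-- The weight `‖x‖ exp (-‖x‖)` has total mass one along every ray for the measure `dσ / σ`. -/
theorem lintegral_Ioi_inv_mul_exp_neg {r : ℝ} (hr : 0 < r) :
    ∫⁻ s in Set.Ioi (0 : ℝ), ENNReal.ofReal s⁻¹ * ENNReal.ofReal (s * r * Real.exp (-(s * r)))
      = 1 := by
  rw [← ProbabilityTheory.lintegral_exponentialPDF_eq_one hr,
    ← lintegral_indicator measurableSet_Ioi]
  refine lintegral_congr_ae ?_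
  filter_upwards [Measure.ae_ne volume (0 : ℝ)] with s hs
  rw [ProbabilityTheory.exponentialPDF_eq]
  rcases lt_or_gt_of_ne hs with h | h
  · simp [h.not_ge, h.le]
  · rw [Set.indicator_of_mem (Set.mem_Ioi.2 h), if_pos h.le,
      ← ENNReal.ofReal_mul (inv_nonneg.2 h.le)]
    congr 1
    rw [mul_comm r s]
    field_simp

/-- Averaging the orbit integrals of `h` under dilations recovers the integral of `h`. -/
theorem lintegral_weight_mul_orbit_lintegral {n : ℕ} [NeZero n] {h : (Fin n → ℝ) → ℝ≥0∞}
    (hh : Measurable h) :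
    ∫⁻ x : Fin n → ℝ, ENNReal.ofReal (‖x‖ * Real.exp (-‖x‖)) *
        ∫⁻ s in Set.Ioi (0 : ℝ), ENNReal.ofReal (s ^ (-(n : ℤ) - 1)) * h (s⁻¹ • x)
      = ∫⁻ x, h x := by
  have hw : Measurable fun x : Fin n → ℝ => ENNReal.ofReal (‖x‖ * Real.exp (-‖x‖)) := by
    fun_prop
  have hp : Measurable fun s : ℝ => ENNReal.ofReal (s ^ (-(n : ℤ) - 1)) :=
    ((measurable_id.pow_const _)).ennreal_ofReal
  have hi : ∀ s ∈ Set.Ioi (0 : ℝ),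
      ∫⁻ x : Fin n → ℝ, ENNReal.ofReal (‖x‖ * Real.exp (-‖x‖)) *
          (ENNReal.ofReal (s ^ (-(n : ℤ) - 1)) * h (s⁻¹ • x))
        = ∫⁻ x, ENNReal.ofReal s⁻¹ * ENNReal.ofReal (s * ‖x‖ * Real.exp (-(s * ‖x‖))) * h x := by
    intro s hs
    have hs : 0 < s := hs
    have hcov := lintegral_inv_smul_fin (h := fun x : Fin n → ℝ =>
      ENNReal.ofReal (s * ‖x‖ * Real.exp (-(s * ‖x‖))) *
        (ENNReal.ofReal (s ^ (-(n : ℤ) - 1)) * h x)) (by fun_prop) hs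
    have hnorm (x : Fin n → ℝ) : s * ‖s⁻¹ • x‖ = ‖x‖ := by
      rw [norm_smul, Real.norm_of_nonneg (inv_nonneg.2 hs.le), mul_inv_cancel_left₀ hs.ne']
    simp only [hnorm] at hcov
    rw [hcov, ← lintegral_const_mul _ (by fun_prop)]
    refine lintegral_congr fun x => ?_
    have hpow : ENNReal.ofReal s⁻¹
        = ENNReal.ofReal (s ^ n) * ENNReal.ofReal (s ^ (-(n : ℤ) - 1)) := by
      rw [← ENNReal.ofReal_mul (pow_nonneg hs.le n), ← zpow_natCast, ← zpow_add₀ hs.ne',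
        show (n : ℤ) + (-(n : ℤ) - 1) = -1 by ring, zpow_neg_one]
    rw [hpow]
    ring
  have hjoint : Measurable fun p : (Fin n → ℝ) × ℝ => h (p.2⁻¹ • p.1) :=
    hh.comp (measurable_snd.inv.smul measurable_fst)
  calc
    _ = ∫⁻ x : Fin n → ℝ, ∫⁻ s in Set.Ioi (0 : ℝ), ENNReal.ofReal (‖x‖ * Real.exp (-‖x‖)) *
          (ENNReal.ofReal (s ^ (-(n : ℤ) - 1)) * h (s⁻¹ • x)) := by
      refine lintegral_congr fun x => (lintegral_const_mul _ ?_).symm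
      exact hp.mul (hjoint.comp measurable_prodMk_left)
    _ = ∫⁻ s in Set.Ioi (0 : ℝ), ∫⁻ x : Fin n → ℝ, ENNReal.ofReal (‖x‖ * Real.exp (-‖x‖)) *
          (ENNReal.ofReal (s ^ (-(n : ℤ) - 1)) * h (s⁻¹ • x)) :=
      lintegral_lintegral_swap
        ((hw.comp measurable_fst).mul ((hp.comp measurable_snd).mul hjoint)).aemeasurable
    _ = ∫⁻ s in Set.Ioi (0 : ℝ), ∫⁻ x : Fin n → ℝ,
          ENNReal.ofReal s⁻¹ * ENNReal.ofReal (s * ‖x‖ * Real.exp (-(s * ‖x‖))) * h x :=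
      setLIntegral_congr_fun measurableSet_Ioi hi
    _ = ∫⁻ x : Fin n → ℝ, ∫⁻ s in Set.Ioi (0 : ℝ),
          ENNReal.ofReal s⁻¹ * ENNReal.ofReal (s * ‖x‖ * Real.exp (-(s * ‖x‖))) * h x :=
      lintegral_lintegral_swap (by fun_prop)
    _ = ∫⁻ x, h x := by
      refine lintegral_congr_ae ?_
      filter_upwards [Measure.ae_ne volume (0 : Fin n → ℝ)] with x hx
      rw [lintegral_mul_const _ (by fun_prop), lintegral_Ioi_inv_mul_exp_neg (norm_pos_iff.2 hx),
        one_mul]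

/-- (Theorem 2.2) If a measurable scale-equivariant estimator `δ₀` minimizes, for
every `x`, the posterior loss under the prior `π(σ) = 1/σ`, then it is best
equivariant: its risk is no larger than that of any measurable scale-equivariant
estimator, at every value of the scale parameter. -/
theorem best_scale_equivariant
    (n : ℕ) (f : (Fin n → ℝ) → ℝ) (hfm : Measurable f) (hf0 : ∀ x, 0 ≤ f x)
    (hf1 : ∫ x, f x = 1)
    (L : ℝ → ℝ≥0∞) (hL : Measurable L)
    (δ₀ : (Fin n → ℝ) → ℝ) (hδ₀m : Measurable δ₀)
    (hδ₀eq : ∀ (c : ℝ), 0 < c → ∀ x : Fin n → ℝ, δ₀ (fun i => c * x i) = c * δ₀ x)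
    (hmin : ∀ (x : Fin n → ℝ) (d : ℝ),
      ∫⁻ σ in Set.Ioi (0 : ℝ),
          L (δ₀ x / σ) * ENNReal.ofReal (σ ^ (-(n : ℤ) - 1) * f (fun i => x i / σ)) ≤
        ∫⁻ σ in Set.Ioi (0 : ℝ),
          L (d / σ) * ENNReal.ofReal (σ ^ (-(n : ℤ) - 1) * f (fun i => x i / σ))) :
    ∀ (δ : (Fin n → ℝ) → ℝ), Measurable δ →
      (∀ (c : ℝ), 0 < c → ∀ x : Fin n → ℝ, δ (fun i => c * x i) = c * δ x) →
      ∀ σ : ℝ, 0 < σ →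
        ∫⁻ x, L (δ₀ x / σ) * ENNReal.ofReal ((σ ^ n)⁻¹ * f (fun i => x i / σ)) ≤
          ∫⁻ x, L (δ x / σ) * ENNReal.ofReal ((σ ^ n)⁻¹ * f (fun i => x i / σ)) := by
  intro δ hδm hδeq σ hσ
  have hdiv (s : ℝ) (x : Fin n → ℝ) : (fun i => x i / s) = s⁻¹ • x := by
    ext i
    simp [div_eq_inv_mul]
  have hequiv {d : (Fin n → ℝ) → ℝ}
      (hd : ∀ c : ℝ, 0 < c → ∀ x : Fin n → ℝ, d (fun i => c * x i) = c * d x)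
      {s : ℝ} (hs : 0 < s) (x : Fin n → ℝ) : d x / s = d (s⁻¹ • x) := by
    rw [div_eq_inv_mul]
    exact (hd s⁻¹ (inv_pos.2 hs) x).symm
  have hmeas {d : (Fin n → ℝ) → ℝ} (hd : Measurable d) :
      Measurable fun x => L (d x) * ENNReal.ofReal (f x) :=
    (hL.comp hd).mul hfm.ennreal_ofReal
  have hrisk {d : (Fin n → ℝ) → ℝ} (hdm : Measurable d)
      (hd : ∀ c : ℝ, 0 < c → ∀ x : Fin n → ℝ, d (fun i => c * x i) = c * d x) :
      ∫⁻ x, L (d x / σ) * ENNReal.ofReal ((σ ^ n)⁻¹ * f (fun i => x i / σ))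
        = ∫⁻ x, L (d x) * ENNReal.ofReal (f x) := by
    have hpos := pow_pos hσ n
    have hint (x : Fin n → ℝ) :
        L (d x / σ) * ENNReal.ofReal ((σ ^ n)⁻¹ * f (fun i => x i / σ))
          = ENNReal.ofReal (σ ^ n)⁻¹ * (L (d (σ⁻¹ • x)) * ENNReal.ofReal (f (σ⁻¹ • x))) := by
      rw [hequiv hd hσ, hdiv, ENNReal.ofReal_mul (inv_nonneg.2 hpos.le), mul_left_comm]
    simp only [hint]
    have hcomp : Measurable fun x => L (d (σ⁻¹ • x)) * ENNReal.ofReal (f (σ⁻¹ • x)) :=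
      (hmeas hdm).comp (measurable_const_smul σ⁻¹)
    rw [lintegral_const_mul _ hcomp, lintegral_inv_smul_fin (hmeas hdm) hσ, ← mul_assoc,
      ← ENNReal.ofReal_mul (inv_nonneg.2 hpos.le), inv_mul_cancel₀ hpos.ne',
      ENNReal.ofReal_one, one_mul]
  have hpost {d : (Fin n → ℝ) → ℝ}
      (hd : ∀ c : ℝ, 0 < c → ∀ x : Fin n → ℝ, d (fun i => c * x i) = c * d x)
      (x : Fin n → ℝ) :
      ∫⁻ s in Set.Ioi (0 : ℝ),
          L (d x / s) * ENNReal.ofReal (s ^ (-(n : ℤ) - 1) * f (fun i => x i / s))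
        = ∫⁻ s in Set.Ioi (0 : ℝ), ENNReal.ofReal (s ^ (-(n : ℤ) - 1)) *
            (L (d (s⁻¹ • x)) * ENNReal.ofReal (f (s⁻¹ • x))) := by
    refine setLIntegral_congr_fun measurableSet_Ioi fun s hs => ?_
    have hs : 0 < s := hs
    simp only [hequiv hd hs, hdiv, ENNReal.ofReal_mul (zpow_nonneg hs.le _), mul_left_comm]
  rw [hrisk hδ₀m hδ₀eq, hrisk hδm hδeq]
  rcases eq_or_ne n 0 with rfl | hn
  · have hzero {d : (Fin 0 → ℝ) → ℝ}
        (hd : ∀ c : ℝ, 0 < c → ∀ x : Fin 0 → ℝ, d (fun i => c * x i) = c * d x)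
        (x : Fin 0 → ℝ) : d x = 0 := by
      have h2 := hd 2 two_pos x
      rw [Subsingleton.elim (fun i => 2 * x i) x] at h2
      linarith
    simp only [hzero hδ₀eq, hzero hδeq, le_refl]
  · have : NeZero n := ⟨hn⟩
    rw [← lintegral_weight_mul_orbit_lintegral (hmeas hδ₀m),
      ← lintegral_weight_mul_orbit_lintegral (hmeas hδm)]
    refine lintegral_mono fun x => mul_le_mul_right ?_ _
    rw [← hpost hδ₀eq, ← hpost hδeq]
    exact hmin x (δ x)
end

section
/- (Theorem 3.2) Assume that for Lebesgue-a.e. x ∈ ℝ^n, 0 < ∫_0^∞ σ^{−n−2} f(x/σ) dσ < ∞ and ∫_0^∞ σ^{−n−1} f(x/σ) dσ < ∞, and that R₀ := ∫_{ℝ^n} (σ̂₀(x) − log σ̂₀(x) − 1) f(x) dx < ∞, where σ̂₀(x) = (∫_0^∞ σ^{−n−1} f(x/σ) dσ)/(∫_0^∞ σ^{−n−2} f(x/σ) dσ) is the Pitman scale estimator. Then σ̂₀ is minimax under entropy loss: ∫_{ℝ^n} L(σ̂₀(x)/σ) σ^{−n} f(x/σ) dx = R₀ for every σ > 0, and for every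 measurable estimator δ : ℝ^n → (0,∞), sup_{σ>0} ∫_{ℝ^n} L(δ(x)/σ) σ^{−n} f(x/σ) dx ≥ R₀. -/
open MeasureTheory ENNReal

/-- The Pitman scale estimator. -/
noncomputable def pitmanScale (n : ℕ) (f : (Fin n → ℝ) → ℝ) (x : Fin n → ℝ) : ℝ :=
  (∫ σ in Set.Ioi (0 : ℝ), σ ^ (-(n : ℤ) - 1) * f (fun i => x i / σ)) /
    (∫ σ in Set.Ioi (0 : ℝ), σ ^ (-(n : ℤ) - 2) * f (fun i => x i / σ))


open Filter Topology

/-- The entropy loss `L(e^u) = e^u - u - 1`, as a function of `u = log t`. -/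
noncomputable def entropyLossExp (u : ℝ) : ℝ≥0∞ := ENNReal.ofReal (Real.exp u - u - 1)

lemma continuous_entropyLossExp : Continuous entropyLossExp := by
  unfold entropyLossExp
  exact ENNReal.continuous_ofReal.comp (by fun_prop)

@[fun_prop]
lemma measurable_entropyLossExp : Measurable entropyLossExp :=
  continuous_entropyLossExp.measurable

lemma ofReal_entropyLoss {t : ℝ} (ht : 0 < t) :
    ENNReal.ofReal (t - Real.log t - 1) = entropyLossExp (Real.log t) := by
  rw [entropyLossExp, Real.exp_log ht]

/-- The posterior expected entropy loss is minimised at the ratio of the moments. -/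
lemma lintegral_entropyLossExp_le (μ : Measure ℝ) [IsFiniteMeasure μ]
    (hB : ∫⁻ t, ENNReal.ofReal (Real.exp (-t)) ∂μ ≠ ∞) (u : ℝ) :
    ∫⁻ t, entropyLossExp (Real.log ((μ Set.univ).toReal /
        (∫⁻ t, ENNReal.ofReal (Real.exp (-t)) ∂μ).toReal) - t) ∂μ ≤
      ∫⁻ t, entropyLossExp (u - t) ∂μ := by
  rcases eq_or_ne μ 0 with rfl | hμ
  · simp
  by_cases h : ∫⁻ t, entropyLossExp (u - t) ∂μ = ∞
  · simp [h]
  set A := (μ Set.univ).toReal with hA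
  set B := (∫⁻ t, ENNReal.ofReal (Real.exp (-t)) ∂μ).toReal with hBdef
  have hApos : 0 < A := ENNReal.toReal_pos (by simpa using hμ) (measure_ne_top _ _)
  have hBpos : 0 < B := by
    refine ENNReal.toReal_pos ?_ hB
    rw [Ne, lintegral_eq_zero_iff (by fun_prop)]
    intro h0
    apply hμ
    rw [← ae_eq_bot, ← Filter.eventually_false_iff_eq_bot]
    filter_upwards [h0] with t ht
    simp at ht
    exact absurd ht (not_le.mpr (Real.exp_pos _))
  have nonneg (v : ℝ) : 0 ≤ Real.exp v - v - 1 := by linarith [Real.add_one_le_exp v]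
  have hexp : Integrable (fun t : ℝ => Real.exp (-t)) μ :=
    (lintegral_ofReal_ne_top_iff_integrable (by fun_prop)
      (ae_of_all _ fun _ => (Real.exp_pos _).le)).1 hB
  have hBint : ∫ t, Real.exp (-t) ∂μ = B :=
    integral_eq_lintegral_of_nonneg_ae (ae_of_all _ fun _ => (Real.exp_pos _).le) (by fun_prop)
  have hu : Integrable (fun t : ℝ => Real.exp (u - t) - (u - t) - 1) μ :=
    (lintegral_ofReal_ne_top_iff_integrable (by fun_prop) (ae_of_all _ fun _ => nonneg _)).1 h
  set v := Real.log (A / B) with hv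
  have hev : Real.exp v = A / B := Real.exp_log (by positivity)
  have heq : (fun t : ℝ => Real.exp (v - t) - (v - t) - 1) = fun t =>
      (Real.exp (u - t) - (u - t) - 1) +
        ((Real.exp v - Real.exp u) * Real.exp (-t) + (u - v)) := by
    ext t
    rw [sub_eq_add_neg v t, sub_eq_add_neg u t, Real.exp_add, Real.exp_add]
    ring
  have hadd : Integrable (fun t : ℝ =>
      (Real.exp v - Real.exp u) * Real.exp (-t) + (u - v)) μ :=
    (hexp.const_mul _).add (integrable_const _)
  have hvint : Integrable (fun t : ℝ => Real.exp (v - t) - (v - t) - 1) μ := by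
    rw [heq]; exact hu.add hadd
  simp only [entropyLossExp]
  rw [← ofReal_integral_eq_lintegral_ofReal hvint (ae_of_all _ fun _ => nonneg _),
    ← ofReal_integral_eq_lintegral_ofReal hu (ae_of_all _ fun _ => nonneg _)]
  apply ENNReal.ofReal_le_ofReal
  rw [heq, integral_add hu hadd, integral_add (hexp.const_mul _) (integrable_const _),
    integral_const_mul, hBint, integral_const, measureReal_def, ← hA, smul_eq_mul]
  have h1 : Real.exp u = A / B * Real.exp (u - v) := by
    rw [← hev, ← Real.exp_add]; ring_nf
  have h2 : (Real.exp v - Real.exp u) * B + A * (u - v) =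
      - (A * (Real.exp (u - v) - (u - v) - 1)) := by
    rw [h1, hev]; field_simp; ring
  rw [h2]
  linarith [mul_nonneg hApos.le (nonneg (u - v))]

variable {n : ℕ}

/-- The density of the scale model at `x`, for the scale parameter `exp t`. -/
noncomputable def scaleDensity (F : (Fin n → ℝ) → ℝ≥0∞) (x : Fin n → ℝ) (t : ℝ) : ℝ≥0∞ :=
  ENNReal.ofReal (Real.exp (-t)) ^ n * F (Real.exp (-t) • x)

/-- The logarithm of the Bayes estimator for the prior `dσ / σ` restricted to `log σ ∈ I`. -/
noncomputable def logBayesScale (F : (Fin n → ℝ) → ℝ≥0∞) (I : Set ℝ) (x : Fin n → ℝ) : ℝ :=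
  Real.log ((∫⁻ t in I, scaleDensity F x t).toReal /
    (∫⁻ t in I, scaleDensity F x t * ENNReal.ofReal (Real.exp (-t))).toReal)

section

variable {F : (Fin n → ℝ) → ℝ≥0∞}

lemma measurable_scaleDensity (hF : Measurable F) :
    Measurable (Function.uncurry (scaleDensity F)) := by
  unfold scaleDensity Function.uncurry
  fun_prop

lemma measurable_logBayesScale (hF : Measurable F) (I : Set ℝ) :
    Measurable (logBayesScale F I) := by
  have h := measurable_scaleDensity hF
  have h1 : Measurable fun x => ∫⁻ t in I, scaleDensity F x t := h.lintegral_prod_right'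
  have h2 : Measurable fun x =>
      ∫⁻ t in I, scaleDensity F x t * ENNReal.ofReal (Real.exp (-t)) := by
    refine Measurable.lintegral_prod_right' (f := fun p : (Fin n → ℝ) × ℝ =>
      scaleDensity F p.1 p.2 * ENNReal.ofReal (Real.exp (-p.2))) ?_
    exact h.mul (by fun_prop)
  exact Real.measurable_log.comp (h1.ennreal_toReal.div h2.ennreal_toReal)

lemma lintegral_scaleDensity_mul (hF : Measurable F) {Φ : (Fin n → ℝ) → ℝ≥0∞}
    (hΦ : Measurable Φ) (t : ℝ) :
    ∫⁻ x, scaleDensity F x t * Φ x = ∫⁻ z, F z * Φ (Real.exp t • z) := by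
  have h : ∀ z : Fin n → ℝ, F z * Φ (Real.exp t • z) =
      (fun x => F (Real.exp (-t) • x) * Φ x) (Real.exp t • z) := fun z => by
    simp [smul_smul, ← Real.exp_add]
  simp_rw [h]
  rw [← lintegral_map (f := fun x => F (Real.exp (-t) • x) * Φ x) (by fun_prop)
    (by fun_prop : Measurable fun z : Fin n → ℝ => Real.exp t • z),
    Measure.map_addHaar_smul _ (Real.exp_pos t).ne', lintegral_smul_measure]
  simp only [scaleDensity, mul_assoc]
  rw [lintegral_const_mul _ (by fun_prop)]
  simp [abs_of_pos, Real.exp_neg, ENNReal.ofReal_pow (Real.exp_pos t).le, Real.exp_pos,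
    ENNReal.inv_pow]

lemma scaleDensity_smul (x : Fin n → ℝ) (s t : ℝ) :
    scaleDensity F (Real.exp s • x) t =
      ENNReal.ofReal (Real.exp (-s)) ^ n * scaleDensity F x (t - s) := by
  simp only [scaleDensity, smul_smul, ← Real.exp_add, ← mul_assoc, ← mul_pow]
  rw [← ENNReal.ofReal_mul (Real.exp_pos _).le, ← Real.exp_add]
  ring_nf

lemma lintegral_scaleDensity_smul (hF : Measurable F) (x : Fin n → ℝ) (s : ℝ) :
    ∫⁻ t, scaleDensity F (Real.exp s • x) t =
      ENNReal.ofReal (Real.exp (-s)) ^ n * ∫⁻ t, scaleDensity F x t := by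
  have h := (measurable_scaleDensity hF).of_uncurry_left (x := x)
  simp_rw [scaleDensity_smul]
  rw [lintegral_const_mul _ (by fun_prop), lintegral_sub_right_eq_self]

lemma inv_lintegral_scaleDensity_smul_mul (hF : Measurable F) (x : Fin n → ℝ) (s : ℝ)
    (c : ℝ≥0∞) :
    (∫⁻ t, scaleDensity F (Real.exp s • x) t)⁻¹ * (ENNReal.ofReal (Real.exp (-s)) ^ n * c) =
      (∫⁻ t, scaleDensity F x t)⁻¹ * c := by
  have h0 : ENNReal.ofReal (Real.exp (-s)) ^ n ≠ 0 := by simp [Real.exp_pos]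
  have h1 : ENNReal.ofReal (Real.exp (-s)) ^ n ≠ ∞ := by simp
  rw [lintegral_scaleDensity_smul hF, ENNReal.mul_inv (.inl h0) (.inl h1)]
  rw [mul_mul_mul_comm, mul_comm]
  rw [ENNReal.inv_mul_cancel h0 h1, mul_one]

/-- Integration over the space, averaged along the orbits of the scaling action. -/
lemma lintegral_eq_lintegral_orbit (hF : Measurable F)
    (hG : ∀ᵐ x, ∫⁻ t, scaleDensity F x t ≠ 0 ∧ ∫⁻ t, scaleDensity F x t ≠ ∞)
    {Φ : (Fin n → ℝ) → ℝ≥0∞} (hΦ : Measurable Φ) :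
    ∫⁻ x, Φ x = ∫⁻ y, F y * ∫⁻ s, (∫⁻ t, scaleDensity F (Real.exp s • y) t)⁻¹ *
      Φ (Real.exp s • y) := by
  have hk := measurable_scaleDensity hF
  have hGm : Measurable fun x => ∫⁻ t, scaleDensity F x t := hk.lintegral_prod_right'
  have hH : Measurable fun x => (∫⁻ t, scaleDensity F x t)⁻¹ * Φ x := hGm.inv.mul hΦ
  have hsm : Measurable fun p : (Fin n → ℝ) × ℝ => Real.exp p.2 • p.1 := by fun_prop
  calc ∫⁻ x, Φ x = ∫⁻ x, ∫⁻ s, scaleDensity F x s * ((∫⁻ t, scaleDensity F x t)⁻¹ * Φ x) := by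
        refine lintegral_congr_ae ?_
        filter_upwards [hG] with x hx
        rw [lintegral_mul_const _ (hk.of_uncurry_left (x := x)), ← mul_assoc,
          ENNReal.mul_inv_cancel hx.1 hx.2, one_mul]
    _ = ∫⁻ s, ∫⁻ x, scaleDensity F x s * ((∫⁻ t, scaleDensity F x t)⁻¹ * Φ x) :=
        lintegral_lintegral_swap (hk.mul (hH.comp measurable_fst)).aemeasurable
    _ = ∫⁻ s, ∫⁻ y, F y * ((∫⁻ t, scaleDensity F (Real.exp s • y) t)⁻¹ *
          Φ (Real.exp s • y)) := by
        simp_rw [fun s => lintegral_scaleDensity_mul hF hH s]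
    _ = ∫⁻ y, ∫⁻ s, F y * ((∫⁻ t, scaleDensity F (Real.exp s • y) t)⁻¹ *
          Φ (Real.exp s • y)) := by
        refine lintegral_lintegral_swap (Measurable.aemeasurable ?_)
        exact (hF.comp measurable_snd).mul (hH.comp (hsm.comp measurable_swap))
    _ = _ := by
        congr 1; ext y
        rw [lintegral_const_mul]
        exact hH.comp (hsm.comp measurable_prodMk_left)

lemma setLIntegral_scaleDensity_mul_le (hF : Measurable F) {x : Fin n → ℝ}
    (hA : ∫⁻ t, scaleDensity F x t ≠ ∞)
    (hB : ∫⁻ t, scaleDensity F x t * ENNReal.ofReal (Real.exp (-t)) ≠ ∞) (I : Set ℝ) (u : ℝ) :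
    ∫⁻ t in I, scaleDensity F x t * entropyLossExp (logBayesScale F I x - t) ≤
      ∫⁻ t in I, scaleDensity F x t * entropyLossExp (u - t) := by
  have hk := (measurable_scaleDensity hF).of_uncurry_left (x := x)
  have key (g : ℝ → ℝ≥0∞) (hg : Measurable g) :
      ∫⁻ t, g t ∂((volume.restrict I).withDensity (scaleDensity F x)) =
        ∫⁻ t in I, scaleDensity F x t * g t :=
    lintegral_withDensity_eq_lintegral_mul _ hk hg
  have hA' : ∫⁻ t in I, scaleDensity F x t ≠ ∞ :=
    ne_top_of_le_ne_top hA (setLIntegral_le_lintegral _ _)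
  have : IsFiniteMeasure ((volume.restrict I).withDensity (scaleDensity F x)) :=
    isFiniteMeasure_withDensity hA'
  have h := lintegral_entropyLossExp_le ((volume.restrict I).withDensity (scaleDensity F x))
    (by rw [key _ (by fun_prop)]
        exact ne_top_of_le_ne_top hB (setLIntegral_le_lintegral _ _)) u
  rw [key _ (by fun_prop), key _ (by fun_prop), key _ (by fun_prop),
    withDensity_apply _ MeasurableSet.univ, Measure.restrict_univ] at h
  exact h

lemma tendsto_logBayesScale (hF : Measurable F) {x : Fin n → ℝ}
    (hA0 : ∫⁻ t, scaleDensity F x t ≠ 0) (hA : ∫⁻ t, scaleDensity F x t ≠ ∞)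
    (hB0 : ∫⁻ t, scaleDensity F x t * ENNReal.ofReal (Real.exp (-t)) ≠ 0)
    (hB : ∫⁻ t, scaleDensity F x t * ENNReal.ofReal (Real.exp (-t)) ≠ ∞) :
    Tendsto (fun M : ℕ => logBayesScale F (Set.Icc (-(M : ℝ)) M) x) atTop
      (𝓝 (logBayesScale F Set.univ x)) := by
  have hk := (measurable_scaleDensity hF).of_uncurry_left (x := x)
  have hcov : AECover (volume : Measure ℝ) atTop fun M : ℕ => Set.Icc (-(M : ℝ)) M :=
    aecover_Icc (tendsto_neg_atTop_atBot.comp tendsto_natCast_atTop_atTop)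
      tendsto_natCast_atTop_atTop
  have h1 := (ENNReal.tendsto_toReal hA).comp
    (hcov.lintegral_tendsto_of_nat hk.aemeasurable)
  have h2 := (ENNReal.tendsto_toReal hB).comp
    (hcov.lintegral_tendsto_of_nat (hk.mul (by fun_prop)).aemeasurable)
  simp only [logBayesScale, Measure.restrict_univ]
  exact (h1.div h2 (ENNReal.toReal_pos hB0 hB).ne').log
    (div_pos (ENNReal.toReal_pos hA0 hA) (ENNReal.toReal_pos hB0 hB)).ne'

lemma logBayesScale_univ_smul (hF : Measurable F) {x : Fin n → ℝ}
    (hA0 : ∫⁻ t, scaleDensity F x t ≠ 0) (hA : ∫⁻ t, scaleDensity F x t ≠ ∞)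
    (hB0 : ∫⁻ t, scaleDensity F x t * ENNReal.ofReal (Real.exp (-t)) ≠ 0)
    (hB : ∫⁻ t, scaleDensity F x t * ENNReal.ofReal (Real.exp (-t)) ≠ ∞) (s : ℝ) :
    logBayesScale F Set.univ (Real.exp s • x) = logBayesScale F Set.univ x + s := by
  have hk := (measurable_scaleDensity hF).of_uncurry_left (x := x)
  have hBs : ∫⁻ t, scaleDensity F (Real.exp s • x) t * ENNReal.ofReal (Real.exp (-t)) =
      ENNReal.ofReal (Real.exp (-s)) ^ n * (ENNReal.ofReal (Real.exp (-s)) *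
        ∫⁻ t, scaleDensity F x t * ENNReal.ofReal (Real.exp (-t))) := by
    rw [← lintegral_const_mul _ (by fun_prop), ← lintegral_const_mul _ (by fun_prop)]
    conv_rhs => rw [← lintegral_sub_right_eq_self _ s]
    congr 1; ext t
    rw [scaleDensity_smul, mul_assoc, mul_left_comm (ENNReal.ofReal (Real.exp (-s))),
      ← ENNReal.ofReal_mul (Real.exp_pos _).le, ← Real.exp_add]
    ring_nf
  simp only [logBayesScale, Measure.restrict_univ]
  rw [hBs, lintegral_scaleDensity_smul hF]
  have hA' := ENNReal.toReal_pos hA0 hA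
  have hB' := ENNReal.toReal_pos hB0 hB
  simp only [ENNReal.toReal_mul, ENNReal.toReal_pow, ENNReal.toReal_ofReal (Real.exp_pos _).le]
  rw [mul_div_mul_left _ _ (pow_pos (Real.exp_pos _) _).ne', Real.exp_neg,
    ← div_div, div_inv_eq_mul, mul_div_right_comm,
    Real.log_mul (div_pos hA' hB').ne' (Real.exp_pos _).ne', Real.log_exp]

/-- The minimal posterior expected loss for the truncated prior bounds the worst-case risk. -/
lemma lintegral_mul_setLIntegral_le (hF : Measurable F)
    (hG : ∀ᵐ x, (∫⁻ t, scaleDensity F x t ≠ 0 ∧ ∫⁻ t, scaleDensity F x t ≠ ∞) ∧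
      ∫⁻ t, scaleDensity F x t * ENNReal.ofReal (Real.exp (-t)) ≠ ∞)
    {d : (Fin n → ℝ) → ℝ} (hd : Measurable d) {r : ℝ≥0∞}
    (hr : ∀ t, ∫⁻ x, scaleDensity F x t * entropyLossExp (d x - t) ≤ r) (M : ℕ) :
    ∫⁻ y, F y * ((∫⁻ t, scaleDensity F y t)⁻¹ * ∫⁻ t in Set.Icc (-(M : ℝ)) M,
      scaleDensity F y t * entropyLossExp (logBayesScale F (Set.Icc (-(M : ℝ)) M) y - t)) ≤
      r := by
  set E := ∫⁻ y, F y * ((∫⁻ t, scaleDensity F y t)⁻¹ * ∫⁻ t in Set.Icc (-(M : ℝ)) M,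
      scaleDensity F y t * entropyLossExp (logBayesScale F (Set.Icc (-(M : ℝ)) M) y - t))
  have hk := measurable_scaleDensity hF
  have hkd : Measurable fun p : (Fin n → ℝ) × ℝ =>
      scaleDensity F p.1 p.2 * entropyLossExp (d p.1 - p.2) :=
    hk.mul (by fun_prop)
  have main (N : ℕ) : (N : ℝ≥0∞) * E ≤ ((2 * M + N : ℕ) : ℝ≥0∞) * r := by
    set J := Set.Icc (0 : ℝ) ((2 * M + N : ℕ) : ℝ)
    have hΦ : Measurable fun x => ∫⁻ t in J, scaleDensity F x t * entropyLossExp (d x - t) :=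
      hkd.lintegral_prod_right'
    calc (N : ℝ≥0∞) * E
        = ∫⁻ y, N * (F y * ((∫⁻ t, scaleDensity F y t)⁻¹ * ∫⁻ t in Set.Icc (-(M : ℝ)) M,
            scaleDensity F y t *
              entropyLossExp (logBayesScale F (Set.Icc (-(M : ℝ)) M) y - t))) :=
          (lintegral_const_mul' _ _ (by simp)).symm
      _ ≤ ∫⁻ y, F y * ∫⁻ s, (∫⁻ t, scaleDensity F (Real.exp s • y) t)⁻¹ *
            ∫⁻ t in J, scaleDensity F (Real.exp s • y) t *
              entropyLossExp (d (Real.exp s • y) - t) := by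
          refine lintegral_mono_ae ?_
          filter_upwards [hG] with y hy
          rw [mul_left_comm]
          gcongr
          have hvol : (N : ℝ≥0∞) = volume (Set.Icc (M : ℝ) (M + N)) := by simp
          rw [hvol, mul_comm, ← setLIntegral_const]
          refine le_trans (setLIntegral_mono' measurableSet_Icc fun s hs => ?_)
            (setLIntegral_le_lintegral _ _)
          have hs' : ∫⁻ t in J, scaleDensity F (Real.exp s • y) t *
                entropyLossExp (d (Real.exp s • y) - t) =
              ENNReal.ofReal (Real.exp (-s)) ^ n * ∫⁻ t in J, scaleDensity F y (t - s) *
                entropyLossExp (d (Real.exp s • y) - t) := by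
            simp_rw [scaleDensity_smul, mul_assoc]
            rw [lintegral_const_mul' _ _ (by simp)]
          rw [hs', inv_lintegral_scaleDensity_smul_mul hF]
          gcongr _ * ?_
          refine (setLIntegral_scaleDensity_mul_le hF hy.1.2 hy.2 _
            (d (Real.exp s • y) - s)).trans ?_
          rw [← lintegral_indicator measurableSet_Icc, ← lintegral_indicator measurableSet_Icc]
          conv_rhs => rw [← lintegral_add_right_eq_self _ s]
          refine lintegral_mono fun t => ?_
          by_cases ht : t ∈ Set.Icc (-(M : ℝ)) M
          · have ht' : t + s ∈ J := by
              simp only [J, Set.mem_Icc] at ht hs ⊢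
              push_cast
              constructor <;> linarith [ht.1, ht.2, hs.1, hs.2]
            rw [Set.indicator_of_mem ht, Set.indicator_of_mem ht', add_sub_cancel_right,
              sub_add_eq_sub_sub_swap]
          · rw [Set.indicator_of_notMem ht]
            exact zero_le
      _ = ∫⁻ x, ∫⁻ t in J, scaleDensity F x t * entropyLossExp (d x - t) :=
          (lintegral_eq_lintegral_orbit hF (hG.mono fun _ h => h.1) hΦ).symm
      _ = ∫⁻ t in J, ∫⁻ x, scaleDensity F x t * entropyLossExp (d x - t) :=
          lintegral_lintegral_swap hkd.aemeasurable
      _ ≤ ∫⁻ t in J, r := lintegral_mono fun t => hr t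
      _ = _ := by
          rw [setLIntegral_const, Real.volume_Icc, sub_zero, ENNReal.ofReal_natCast, mul_comm]
  rcases eq_or_ne r ∞ with rfl | hrtop
  · simp
  have hEtop : E ≠ ∞ := by
    rintro h
    have := main 1
    rw [h, Nat.cast_one, one_mul, top_le_iff] at this
    exact ENNReal.mul_ne_top (ENNReal.natCast_ne_top _) hrtop this
  rw [← ENNReal.toReal_le_toReal hEtop hrtop]
  by_contra! hlt
  obtain ⟨N, hN⟩ := exists_nat_gt (2 * M * r.toReal / (E.toReal - r.toReal))
  rw [div_lt_iff₀ (sub_pos.2 hlt)] at hN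
  have hle := ENNReal.toReal_mono (ENNReal.mul_ne_top (ENNReal.natCast_ne_top _) hrtop) (main N)
  simp only [ENNReal.toReal_mul, ENNReal.toReal_natCast] at hle
  push_cast at hle
  linarith

/-- The identity expressing the risk of the Pitman estimator as a mean posterior loss. -/
lemma lintegral_mul_entropyLossExp_eq (hF : Measurable F)
    (hG : ∀ᵐ x, (∫⁻ t, scaleDensity F x t ≠ 0 ∧ ∫⁻ t, scaleDensity F x t ≠ ∞) ∧
      ∫⁻ t, scaleDensity F x t * ENNReal.ofReal (Real.exp (-t)) ≠ 0 ∧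
      ∫⁻ t, scaleDensity F x t * ENNReal.ofReal (Real.exp (-t)) ≠ ∞) :
    ∫⁻ y, F y * entropyLossExp (logBayesScale F Set.univ y) =
      ∫⁻ y, F y * ((∫⁻ t, scaleDensity F y t)⁻¹ * ∫⁻ t,
        scaleDensity F y t * entropyLossExp (logBayesScale F Set.univ y - t)) := by
  have hD := measurable_logBayesScale hF Set.univ
  rw [lintegral_eq_lintegral_orbit hF (hG.mono fun _ h => h.1) (by fun_prop)]
  refine lintegral_congr_ae ?_
  filter_upwards [hG] with y ⟨⟨hA0, hA⟩, hB0, hB⟩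
  have hk := (measurable_scaleDensity hF).of_uncurry_left (x := y)
  rw [← lintegral_const_mul _ (by fun_prop : Measurable fun t =>
    scaleDensity F y t * entropyLossExp (logBayesScale F Set.univ y - t))]
  congr 1
  refine (lintegral_neg_eq_self _).symm.trans (lintegral_congr fun s => ?_)
  have hFs : F (Real.exp (-s) • y) =
      ENNReal.ofReal (Real.exp (-(-s))) ^ n * scaleDensity F y s := by
    rw [scaleDensity, ← mul_assoc, ← mul_pow, ← ENNReal.ofReal_mul (Real.exp_pos _).le,
      ← Real.exp_add]
    simp
  rw [logBayesScale_univ_smul hF hA0 hA hB0 hB, ← sub_eq_add_neg, hFs, mul_assoc,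
    inv_lintegral_scaleDensity_smul_mul hF]

lemma lintegral_mul_entropyLossExp_le (hF : Measurable F)
    (hG : ∀ᵐ x, (∫⁻ t, scaleDensity F x t ≠ 0 ∧ ∫⁻ t, scaleDensity F x t ≠ ∞) ∧
      ∫⁻ t, scaleDensity F x t * ENNReal.ofReal (Real.exp (-t)) ≠ 0 ∧
      ∫⁻ t, scaleDensity F x t * ENNReal.ofReal (Real.exp (-t)) ≠ ∞)
    {d : (Fin n → ℝ) → ℝ} (hd : Measurable d) {r : ℝ≥0∞}
    (hr : ∀ t, ∫⁻ x, scaleDensity F x t * entropyLossExp (d x - t) ≤ r) :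
    ∫⁻ y, F y * entropyLossExp (logBayesScale F Set.univ y) ≤ r := by
  have hk := measurable_scaleDensity hF
  set Q : ℕ → (Fin n → ℝ) → ℝ≥0∞ := fun M y => ∫⁻ t in Set.Icc (-(M : ℝ)) M,
    scaleDensity F y t * entropyLossExp (logBayesScale F (Set.Icc (-(M : ℝ)) M) y - t) with hQ
  have hQm (M : ℕ) : Measurable (Q M) := by
    have hD := measurable_logBayesScale hF (Set.Icc (-(M : ℝ)) M)
    refine Measurable.lintegral_prod_right' (f := fun p : (Fin n → ℝ) × ℝ =>
      scaleDensity F p.1 p.2 *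
        entropyLossExp (logBayesScale F (Set.Icc (-(M : ℝ)) M) p.1 - p.2)) ?_
    exact hk.mul (by fun_prop)
  have hGm : Measurable fun x => ∫⁻ t, scaleDensity F x t := hk.lintegral_prod_right'
  rw [lintegral_mul_entropyLossExp_eq hF hG]
  calc _ ≤ ∫⁻ y, liminf (fun M => F y * ((∫⁻ t, scaleDensity F y t)⁻¹ * Q M y)) atTop := by
        refine lintegral_mono_ae ?_
        filter_upwards [hG] with y ⟨⟨hA0, hA⟩, hB0, hB⟩
        have hky := hk.of_uncurry_left (x := y)
        have hfatou : ∫⁻ t, scaleDensity F y t *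
            entropyLossExp (logBayesScale F Set.univ y - t) ≤ liminf (fun M => Q M y) atTop := by
          simp only [hQ, ← lintegral_indicator (measurableSet_Icc (α := ℝ))]
          refine le_trans (lintegral_mono_ae ?_) (lintegral_liminf_le fun M =>
            (by fun_prop : Measurable fun t => scaleDensity F y t * entropyLossExp
              (logBayesScale F (Set.Icc (-(M : ℝ)) M) y - t)).indicator measurableSet_Icc)
          filter_upwards [ae_lt_top hky hA] with t ht
          have hlim : Tendsto (fun M : ℕ => scaleDensity F y t * entropyLossExp
              (logBayesScale F (Set.Icc (-(M : ℝ)) M) y - t)) atTop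
              (𝓝 (scaleDensity F y t * entropyLossExp (logBayesScale F Set.univ y - t))) :=
            ENNReal.Tendsto.const_mul ((continuous_entropyLossExp.tendsto _).comp
              ((tendsto_logBayesScale hF hA0 hA hB0 hB).sub_const t)) (.inr ht.ne)
          refine (hlim.congr' ?_).liminf_eq.ge
          filter_upwards [eventually_ge_atTop ⌈|t|⌉₊] with M hM
          rw [Set.indicator_of_mem]
          exact abs_le.1 ((Nat.le_ceil _).trans (by exact_mod_cast hM))
        simp_rw [← mul_assoc]
        have hmul := ENNReal.le_liminf_mul (f := atTop) (v := fun M => Q M y)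
          (u := fun _ => F y * (∫⁻ t, scaleDensity F y t)⁻¹)
        rw [liminf_const] at hmul
        exact le_trans (by gcongr) hmul
    _ ≤ liminf (fun M => ∫⁻ y, F y * ((∫⁻ t, scaleDensity F y t)⁻¹ * Q M y)) atTop :=
        lintegral_liminf_le fun M => hF.mul (hGm.inv.mul (hQm M))
    _ ≤ r := by
        refine liminf_le_of_frequently_le' (Frequently.of_forall fun M => ?_)
        exact lintegral_mul_setLIntegral_le hF (hG.mono fun _ h => ⟨h.1, h.2.2⟩) hd hr M

lemma setLIntegral_Ioi_eq_lintegral_exp (h : ℝ → ℝ≥0∞) :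
    ∫⁻ σ in Set.Ioi 0, h σ = ∫⁻ t, ENNReal.ofReal (Real.exp t) * h (Real.exp t) := by
  have := lintegral_image_eq_lintegral_abs_deriv_mul MeasurableSet.univ
    (fun t _ => (Real.hasDerivAt_exp t).hasDerivWithinAt) Real.exp_injective.injOn h
  simpa [Set.image_univ, Real.range_exp, abs_of_pos, Real.exp_pos] using this

end

lemma setLIntegral_Ioi_zpow_mul {f : (Fin n → ℝ) → ℝ} (x : Fin n → ℝ) (m : ℕ) :
    ∫⁻ σ in Set.Ioi (0 : ℝ),
        ENNReal.ofReal (σ ^ (-(n : ℤ) - (m + 1 : ℤ)) * f (fun i => x i / σ)) =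
      ∫⁻ t, scaleDensity (fun x => ENNReal.ofReal (f x)) x t *
        ENNReal.ofReal (Real.exp (-t)) ^ m := by
  rw [setLIntegral_Ioi_eq_lintegral_exp]
  congr 1; ext t
  have hx : (fun i => x i / Real.exp t) = Real.exp (-t) • x := by
    ext i; simp [Real.exp_neg, div_eq_inv_mul]
  have h0 := Real.exp_pos t
  rw [hx, scaleDensity, ENNReal.ofReal_mul (by positivity), ← mul_assoc,
    ← ENNReal.ofReal_mul h0.le, mul_right_comm, ← pow_add, ← ENNReal.ofReal_pow (Real.exp_pos _).le]
  congr 2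
  rw [Real.exp_neg, ← zpow_one_add₀ h0.ne', inv_pow, ← zpow_natCast, ← zpow_neg]
  congr 1
  push_cast; ring

lemma integral_Ioi_zpow_mul {f : (Fin n → ℝ) → ℝ} (hf : Measurable f) (hf0 : ∀ x, 0 ≤ f x)
    (x : Fin n → ℝ) (m : ℕ) :
    ∫ σ in Set.Ioi (0 : ℝ), σ ^ (-(n : ℤ) - (m + 1 : ℤ)) * f (fun i => x i / σ) =
      (∫⁻ t, scaleDensity (fun x => ENNReal.ofReal (f x)) x t *
        ENNReal.ofReal (Real.exp (-t)) ^ m).toReal := by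
  rw [← setLIntegral_Ioi_zpow_mul, integral_eq_lintegral_of_nonneg_ae]
  · filter_upwards [ae_restrict_mem measurableSet_Ioi] with σ hσ
    have hσ : 0 < σ := hσ
    have := hf0 (fun i => x i / σ)
    simp only [Pi.zero_apply]
    positivity
  · exact (by fun_prop : Measurable fun σ : ℝ => σ ^ (-(n : ℤ) - (m + 1 : ℤ)) *
      f (fun i => x i / σ)).aestronglyMeasurable

lemma pitmanScale_eq {f : (Fin n → ℝ) → ℝ} (hf : Measurable f) (hf0 : ∀ x, 0 ≤ f x)
    (x : Fin n → ℝ) :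
    pitmanScale n f x = (∫⁻ t, scaleDensity (fun x => ENNReal.ofReal (f x)) x t).toReal /
      (∫⁻ t, scaleDensity (fun x => ENNReal.ofReal (f x)) x t *
        ENNReal.ofReal (Real.exp (-t))).toReal := by
  have h0 := integral_Ioi_zpow_mul hf hf0 x 0
  have h1 := integral_Ioi_zpow_mul hf hf0 x 1
  norm_num at h0 h1
  rw [pitmanScale, h0, h1]

lemma ofReal_entropyLoss_mul_density {f : (Fin n → ℝ) → ℝ} (hf0 : ∀ x, 0 ≤ f x)
    (x : Fin n → ℝ) {d : ℝ} (hd : 0 < d) (t : ℝ) :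
    ENNReal.ofReal ((d / Real.exp t - Real.log (d / Real.exp t) - 1) *
        ((Real.exp t ^ n)⁻¹ * f (fun i => x i / Real.exp t))) =
      scaleDensity (fun x => ENNReal.ofReal (f x)) x t * entropyLossExp (Real.log d - t) := by
  have hx : (fun i => x i / Real.exp t) = Real.exp (-t) • x := by
    ext i; simp [Real.exp_neg, div_eq_inv_mul]
  have h0 := Real.exp_pos t
  rw [hx, ENNReal.ofReal_mul' (mul_nonneg (by positivity) (hf0 _)),
    ofReal_entropyLoss (by positivity), Real.log_div hd.ne' h0.ne', Real.log_exp,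
    ENNReal.ofReal_mul (by positivity), scaleDensity, Real.exp_neg, ← inv_pow,
    ENNReal.ofReal_pow (by positivity), mul_comm]

lemma scaleDensity_moments {f : (Fin n → ℝ) → ℝ} (hf : Measurable f) (hf0 : ∀ x, 0 ≤ f x)
    {x : Fin n → ℝ}
    (h2 : IntegrableOn (fun σ : ℝ => σ ^ (-(n : ℤ) - 2) * f (fun i => x i / σ)) (Set.Ioi 0))
    (hpos : 0 < (∫ σ in Set.Ioi (0 : ℝ), σ ^ (-(n : ℤ) - 2) * f (fun i => x i / σ)))
    (h1 : IntegrableOn (fun σ : ℝ => σ ^ (-(n : ℤ) - 1) * f (fun i => x i / σ)) (Set.Ioi 0)) :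
    (∫⁻ t, scaleDensity (fun x => ENNReal.ofReal (f x)) x t ≠ 0 ∧
      ∫⁻ t, scaleDensity (fun x => ENNReal.ofReal (f x)) x t ≠ ∞) ∧
      ∫⁻ t, scaleDensity (fun x => ENNReal.ofReal (f x)) x t *
        ENNReal.ofReal (Real.exp (-t)) ≠ 0 ∧
      ∫⁻ t, scaleDensity (fun x => ENNReal.ofReal (f x)) x t *
        ENNReal.ofReal (Real.exp (-t)) ≠ ∞ := by
  have hk := (measurable_scaleDensity (F := fun x => ENNReal.ofReal (f x))
    (by fun_prop)).of_uncurry_left (x := x)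
  have e1 := setLIntegral_Ioi_zpow_mul (f := f) x 0
  have e2 := setLIntegral_Ioi_zpow_mul (f := f) x 1
  have e3 := integral_Ioi_zpow_mul hf hf0 x 1
  norm_num at e1 e2 e3
  have hB0 : ∫⁻ t, scaleDensity (fun x => ENNReal.ofReal (f x)) x t *
      ENNReal.ofReal (Real.exp (-t)) ≠ 0 := by
    intro h
    rw [e3, h] at hpos
    simp at hpos
  refine ⟨⟨fun h => hB0 ?_, e1 ▸ h1.lintegral_lt_top.ne⟩, hB0, e2 ▸ h2.lintegral_lt_top.ne⟩
  rw [lintegral_eq_zero_iff hk] at h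
  rw [lintegral_eq_zero_iff (by fun_prop)]
  filter_upwards [h] with t ht
  simp [ht]

/-- (Theorem 3.2) The Pitman scale estimator is minimax under entropy loss
`L(t) = t - log t - 1`: its risk is constant, equal to `R₀`, and every measurable
positive estimator has supremum risk at least `R₀`. -/
theorem pitmanScale_minimax
    (n : ℕ) (f : (Fin n → ℝ) → ℝ) (hfm : Measurable f) (hf0 : ∀ x, 0 ≤ f x)
    (hf1 : ∫ x, f x = 1)
    (hae : ∀ᵐ x : Fin n → ℝ,
      IntegrableOn (fun σ : ℝ => σ ^ (-(n : ℤ) - 2) * f (fun i => x i / σ)) (Set.Ioi 0) ∧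
      0 < (∫ σ in Set.Ioi (0 : ℝ), σ ^ (-(n : ℤ) - 2) * f (fun i => x i / σ)) ∧
      IntegrableOn (fun σ : ℝ => σ ^ (-(n : ℤ) - 1) * f (fun i => x i / σ)) (Set.Ioi 0))
    (R₀ : ℝ≥0∞)
    (hR₀ : R₀ = ∫⁻ x, ENNReal.ofReal
      ((pitmanScale n f x - Real.log (pitmanScale n f x) - 1) * f x))
    (hR₀fin : R₀ < ⊤) :
    (∀ σ : ℝ, 0 < σ →
      ∫⁻ x, ENNReal.ofReal
        ((pitmanScale n f x / σ - Real.log (pitmanScale n f x / σ) - 1) *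
          ((σ ^ n)⁻¹ * f (fun i => x i / σ))) = R₀) ∧
    (∀ δ : (Fin n → ℝ) → ℝ, Measurable δ → (∀ x, 0 < δ x) →
      R₀ ≤ ⨆ (σ : ℝ) (_ : 0 < σ),
        ∫⁻ x, ENNReal.ofReal
          ((δ x / σ - Real.log (δ x / σ) - 1) * ((σ ^ n)⁻¹ * f (fun i => x i / σ)))) := by
  have hF : Measurable fun x => ENNReal.ofReal (f x) := hfm.ennreal_ofReal
  set F : (Fin n → ℝ) → ℝ≥0∞ := fun x => ENNReal.ofReal (f x) with hFdef
  have hG := hae.mono fun x hx => scaleDensity_moments hfm hf0 hx.1 hx.2.1 hx.2.2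
  have hlog (x : Fin n → ℝ) : Real.log (pitmanScale n f x) = logBayesScale F Set.univ x := by
    rw [pitmanScale_eq hfm hf0, logBayesScale, Measure.restrict_univ]
  have hpos : ∀ᵐ x, 0 < pitmanScale n f x := hG.mono fun x hx => by
    rw [pitmanScale_eq hfm hf0]
    exact div_pos (ENNReal.toReal_pos hx.1.1 hx.1.2) (ENNReal.toReal_pos hx.2.1 hx.2.2)
  have hD := measurable_logBayesScale hF Set.univ
  have hR : R₀ = ∫⁻ x, F x * entropyLossExp (logBayesScale F Set.univ x) := by
    rw [hR₀]
    refine lintegral_congr_ae ?_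
    filter_upwards [hpos] with x hx
    rw [ENNReal.ofReal_mul' (hf0 x), ofReal_entropyLoss hx, hlog, mul_comm]
  refine ⟨fun σ hσ => ?_, fun δ hδ hδ0 => ?_⟩
  · obtain ⟨t, rfl⟩ : ∃ t, Real.exp t = σ := ⟨_, Real.exp_log hσ⟩
    calc _ = ∫⁻ x, scaleDensity F x t * entropyLossExp (logBayesScale F Set.univ x - t) := by
          refine lintegral_congr_ae ?_
          filter_upwards [hpos] with x hx
          rw [ofReal_entropyLoss_mul_density hf0 x hx, hlog]
      _ = ∫⁻ z, F z * entropyLossExp (logBayesScale F Set.univ (Real.exp t • z) - t) :=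
          lintegral_scaleDensity_mul hF
            (Φ := fun x => entropyLossExp (logBayesScale F Set.univ x - t)) (by fun_prop) t
      _ = R₀ := by
          rw [hR]
          refine lintegral_congr_ae ?_
          filter_upwards [hG] with x ⟨⟨hA0, hA⟩, hB0, hB⟩
          rw [logBayesScale_univ_smul hF hA0 hA hB0 hB, add_sub_cancel_right]
  · rw [hR]
    refine lintegral_mul_entropyLossExp_le hF hG (d := fun x => Real.log (δ x)) (by fun_prop)
      fun t => ?_
    refine le_trans (le_of_eq ?_) (le_iSup₂ (Real.exp t) (Real.exp_pos t))
    exact lintegral_congr fun x => (ofReal_entropyLoss_mul_density hf0 x (hδ0 x) t).symm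
end

section
/- The measure ν(dZ) = ∏_{i=1}^p z_{ii}^{−(p−i+1)} dZ on T⁺ is right invariant under the group of lower-triangular matrices with positive diagonal: for every B ∈ T⁺ and every measurable g : T⁺ → [0,∞], ∫_{T⁺} g(Z B) ∏_{i=1}^p z_{ii}^{−(p−i+1)} dZ = ∫_{T⁺} g(Z) ∏_{i=1}^p z_{ii}^{−(p−i+1)} dZ. -/
open MeasureTheory ENNReal Matrix

/-- The index set of the lower-triangular entries of a `p × p` matrix. -/
abbrev LowIdx (p : ℕ) := {q : Fin p × Fin p // q.2 ≤ q.1}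

/-- Coordinates for lower-triangular matrices: `ℝ^{p(p+1)/2}`. -/
abbrev TriCoords (p : ℕ) := LowIdx p → ℝ

/-- The lower-triangular matrix determined by coordinates `x`. -/
noncomputable def triMat {p : ℕ} (x : TriCoords p) : Matrix (Fin p) (Fin p) ℝ :=
  Matrix.of fun i j => if h : j ≤ i then x ⟨(i, j), h⟩ else 0

/-- The (coordinates of) `T⁺`: lower-triangular matrices with positive diagonal. -/
def triPos (p : ℕ) : Set (TriCoords p) :=
  {x | ∀ i : Fin p, 0 < x ⟨(i, i), le_rfl⟩}

/-- The density of the right-invariant measure `ν(dZ) = ∏ z_{ii}^{-(p-i+1)} dZ` on `T⁺`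
(with respect to Lebesgue measure on the lower-triangular coordinates). -/
noncomputable def nuDens {p : ℕ} (z : TriCoords p) : ℝ≥0∞ :=
  ∏ i : Fin p, ENNReal.ofReal (z ⟨(i, i), le_rfl⟩ ^ (-((p : ℤ) - (i : ℕ))))

instance matrixMeasurableSpace {p : ℕ} : MeasurableSpace (Matrix (Fin p) (Fin p) ℝ) :=
  inferInstanceAs (MeasurableSpace (Fin p → Fin p → ℝ))

/-- A matrix belongs to `T⁺`: lower triangular with strictly positive diagonal. -/
def memTplus {p : ℕ} (A : Matrix (Fin p) (Fin p) ℝ) : Prop :=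
  (∀ i j : Fin p, i < j → A i j = 0) ∧ ∀ i : Fin p, 0 < A i i

/-- The matrix, in triangular coordinates, of right multiplication by `B`. -/
noncomputable def rightMulMatrix {p : ℕ} (B : Matrix (Fin p) (Fin p) ℝ) :
    Matrix (LowIdx p) (LowIdx p) ℝ :=
  Matrix.of fun q r => if q.1.1 = r.1.1 then B r.1.2 q.1.2 else 0

lemma card_lowIdx_col {p : ℕ} (k : Fin p) :
    Fintype.card {q : LowIdx p // q.1.2 = k} = p - k := by
  let e : {q : LowIdx p // q.1.2 = k} ≃ Set.Ici k :=
    { toFun := fun q => ⟨q.1.1.1, by simpa [← q.2] using q.1.2⟩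
      invFun := fun i => ⟨⟨(i, k), i.2⟩, rfl⟩
      left_inv := by rintro ⟨⟨⟨i, j⟩, h⟩, rfl⟩; rfl
      right_inv := fun i => rfl }
  rw [Fintype.card_congr e, Fintype.card_ofFinset (Finset.Ici k) (by simp), Fin.card_Ici]

lemma det_rightMulMatrix {p : ℕ} {B : Matrix (Fin p) (Fin p) ℝ}
    (hB : ∀ i j, i < j → B i j = 0) :
    (rightMulMatrix B).det = ∏ k : Fin p, B k k ^ (p - (k : ℕ)) := by
  have hM : (rightMulMatrix B).BlockTriangular fun q => q.1.2 := by
    intro q r h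
    simp [rightMulMatrix, hB _ _ h]
  rw [hM.det_fintype]
  refine Finset.prod_congr rfl fun k _ => ?_
  have hblock : (rightMulMatrix B).toSquareBlock (fun q => q.1.2) k =
      Matrix.diagonal fun _ => B k k := by
    ext ⟨⟨⟨i, j⟩, h⟩, hj⟩ ⟨⟨⟨i', j'⟩, h'⟩, hj'⟩
    dsimp only at hj hj'
    subst hj hj'
    simp [rightMulMatrix, Matrix.toSquareBlock_def, Matrix.diagonal_apply]
  rw [hblock, Matrix.det_diagonal, Finset.prod_const, Finset.card_univ, card_lowIdx_col]

lemma rightMulMatrix_mulVec_apply {p : ℕ} (B : Matrix (Fin p) (Fin p) ℝ)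
    (z : TriCoords p) (q : LowIdx p) :
    (rightMulMatrix B *ᵥ z) q = (triMat z * B) q.1.1 q.1.2 := by
  let f : Fin p × Fin p → ℝ := fun r =>
    if q.1.1 = r.1 then triMat z r.1 r.2 * B r.2 q.1.2 else 0
  calc
    (rightMulMatrix B *ᵥ z) q = ∑ r, f r := by
      refine Fintype.sum_of_injective Subtype.val Subtype.val_injective _ _ ?_ ?_
      · intro r hr
        have h : ¬ r.2 ≤ r.1 := fun h => hr ⟨⟨r, h⟩, rfl⟩
        simp [f, triMat, h]
      · rintro ⟨r, h⟩
        simp [f, triMat, rightMulMatrix, h, mul_comm]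
    _ = (triMat z * B) q.1.1 q.1.2 := by
      simp [f, Fintype.sum_prod_type_right, Matrix.mul_apply]

lemma triMat_rightMulMatrix_mulVec {p : ℕ} {B : Matrix (Fin p) (Fin p) ℝ}
    (hB : ∀ i j, i < j → B i j = 0) (z : TriCoords p) :
    triMat (rightMulMatrix B *ᵥ z) = triMat z * B := by
  ext i j
  by_cases h : j ≤ i
  · simp [triMat, h, rightMulMatrix_mulVec_apply]
  · have : (triMat z * B) i j = 0 := by
      rw [Matrix.mul_apply]
      refine Finset.sum_eq_zero fun k _ => ?_
      by_cases hk : k ≤ i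
      · simp [hB k j (hk.trans_lt (not_le.mp h))]
      · simp [triMat, hk]
    rw [this]
    simp [triMat, h]

lemma rightMulMatrix_mulVec_diag {p : ℕ} {B : Matrix (Fin p) (Fin p) ℝ}
    (hB : ∀ i j, i < j → B i j = 0) (z : TriCoords p) (i : Fin p) :
    (rightMulMatrix B *ᵥ z) ⟨(i, i), le_rfl⟩ = z ⟨(i, i), le_rfl⟩ * B i i := by
  rw [rightMulMatrix_mulVec_apply, Matrix.mul_apply, Finset.sum_eq_single i]
  · simp [triMat]
  · intro k _ hk
    rcases hk.lt_or_gt with hk | hk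
    · simp [hB k i hk]
    · simp [triMat, hk.not_ge]
  · simp

lemma rightMulMatrix_mulVec_mem_triPos {p : ℕ} {B : Matrix (Fin p) (Fin p) ℝ}
    (hB : memTplus B) (z : TriCoords p) :
    rightMulMatrix B *ᵥ z ∈ triPos p ↔ z ∈ triPos p := by
  simp only [triPos, Set.mem_ofPred_eq, rightMulMatrix_mulVec_diag hB.1,
    mul_pos_iff_of_pos_right (hB.2 _)]

lemma nuDens_rightMulMatrix_mulVec {p : ℕ} {B : Matrix (Fin p) (Fin p) ℝ}
    (hB : memTplus B) (z : TriCoords p) :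
    nuDens (rightMulMatrix B *ᵥ z) =
      nuDens z * ENNReal.ofReal |(rightMulMatrix B).det⁻¹| := by
  have hdet : |(rightMulMatrix B).det⁻¹| = ∏ i : Fin p, B i i ^ (-((p : ℤ) - (i : ℕ))) := by
    rw [det_rightMulMatrix hB.1, abs_of_nonneg
      (inv_nonneg.2 (Finset.prod_nonneg fun i _ => pow_nonneg (hB.2 i).le _)),
      ← Finset.prod_inv_distrib]
    refine Finset.prod_congr rfl fun i _ => ?_
    rw [_root_.zpow_neg, ← Nat.cast_sub i.2.le, zpow_natCast]
  rw [hdet, ENNReal.ofReal_prod_of_nonneg fun i _ => zpow_nonneg (hB.2 i).le _]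
  simp only [nuDens, rightMulMatrix_mulVec_diag hB.1, mul_zpow,
    ENNReal.ofReal_mul' (zpow_nonneg (hB.2 _).le _), Finset.prod_mul_distrib]

lemma measurable_triMat {p : ℕ} : Measurable (triMat (p := p)) := by
  refine measurable_pi_iff.2 fun i => measurable_pi_iff.2 fun j => ?_
  by_cases h : j ≤ i
  · simpa [triMat, h] using measurable_pi_apply _
  · simp [triMat, h]

lemma measurable_nuDens {p : ℕ} : Measurable (nuDens (p := p)) :=
  Finset.measurable_fun_prod _ fun _ _ =>
    ((measurable_pi_apply _).pow_const _).ennreal_ofReal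

lemma measurableSet_triPos (p : ℕ) : MeasurableSet (triPos p) := by
  simp only [triPos, Set.ofPred_forall]
  exact MeasurableSet.iInter fun i => measurableSet_lt measurable_const (measurable_pi_apply _)

/-- The measure `ν(dZ) = ∏ z_{ii}^{-(p-i+1)} dZ` on `T⁺` is right invariant under the
group of lower-triangular matrices with positive diagonal. -/
theorem nu_right_invariant
    (p : ℕ) (hp : 1 ≤ p)
    (B : Matrix (Fin p) (Fin p) ℝ) (hB : memTplus B)
    (g : Matrix (Fin p) (Fin p) ℝ → ℝ≥0∞) (hg : Measurable g) :
    ∫⁻ z in triPos p, g (triMat z * B) * nuDens z =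
      ∫⁻ z in triPos p, g (triMat z) * nuDens z := by
  have hdet : (rightMulMatrix B).det ≠ 0 := by
    rw [det_rightMulMatrix hB.1]
    exact Finset.prod_ne_zero_iff.2 fun i _ => pow_ne_zero _ (hB.2 i).ne'
  set c := ENNReal.ofReal |(rightMulMatrix B).det⁻¹| with hc
  have hc0 : c ≠ 0 := by simpa [hc] using hdet
  have hF : Measurable fun z : TriCoords p => g (triMat z) * nuDens z :=
    (hg.comp measurable_triMat).mul measurable_nuDens
  have hpre : Matrix.toLin' (rightMulMatrix B) ⁻¹' triPos p = triPos p :=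
    Set.ext fun z => rightMulMatrix_mulVec_mem_triPos hB z
  have key : ∫⁻ z in triPos p, g (triMat z * B) * nuDens z * c =
      c * ∫⁻ z in triPos p, g (triMat z) * nuDens z := by
    rw [← smul_eq_mul, ← lintegral_smul_measure, ← Measure.restrict_smul,
      ← Real.map_matrix_volume_pi_eq_smul_volume_pi hdet,
      setLIntegral_map (measurableSet_triPos p) hF
        (LinearMap.continuous_of_finiteDimensional _).measurable, hpre]
    refine lintegral_congr fun z => ?_
    rw [Matrix.toLin'_apply, triMat_rightMulMatrix_mulVec hB.1,
      nuDens_rightMulMatrix_mulVec hB, mul_assoc]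
  rw [lintegral_mul_const' _ _ ENNReal.ofReal_ne_top, mul_comm] at key
  exact (ENNReal.mul_right_inj hc0 ENNReal.ofReal_ne_top).1 key
end

section
/- For every measurable equivariant estimator in the Wishart model, the risk is constant in the parameter: if δ : T⁺ → (p×p symmetric positive definite matrices) satisfies δ(A T) = A δ(T) Aᵀ for all A, T ∈ T⁺, then for every Θ ∈ T⁺, ∫_{T⁺} L(Θ δ(T) Θᵀ) f_W(T | Θ) γ(dT) = ∫_{T⁺} L(δ(Z)) f_W(Z | I_p) γ(dZ), where L is any measurable function from p×p matrices to [0,∞]. -/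
open MeasureTheory ENNReal Matrix

noncomputable def gammaDens {p : ℕ} (x : TriCoords p) : ℝ≥0∞ :=
  ∏ i : Fin p, ENNReal.ofReal (x ⟨(i, i), le_rfl⟩ ^ (-((i : ℕ) + 1) : ℤ))

noncomputable def gammaDensR {p : ℕ} (x : TriCoords p) : ℝ :=
  ∏ i : Fin p, x ⟨(i, i), le_rfl⟩ ^ (-((i : ℕ) + 1) : ℤ)

noncomputable def wishartC (p n : ℕ) : ℝ :=
  2 ^ ((p : ℝ) * ((n : ℝ) - 2) / 2) * Real.pi ^ ((p : ℝ) * ((p : ℝ) - 1) / 4) *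
    ∏ i : Fin p, Real.Gamma (((n : ℝ) - (i : ℕ)) / 2)

noncomputable def wishartDens (p n : ℕ) (Θ T : Matrix (Fin p) (Fin p) ℝ) : ℝ :=
  (Θ * T).det ^ n * Real.exp (-(1 / 2) * ((Θ * T) * (Θ * T)ᵀ).trace) / wishartC p n

lemma Matrix.BlockTriangular.det_eq_prod_diag_of_injective {m α R : Type*} [Fintype m]
    [DecidableEq m] [LinearOrder α] [CommRing R] {M : Matrix m m R} {b : m → α}
    (hM : M.BlockTriangular b) (hb : Function.Injective b) : M.det = ∏ i, M i i := by
  let : LinearOrder m := LinearOrder.lift' b hb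
  have h : M.BlockTriangular id := fun i j hij => hM hij
  convert Matrix.det_of_isUpperTriangular h

/-- Left multiplication by a matrix, followed by restriction to the lower triangular entries. -/
noncomputable def triMulLeft {p : ℕ} (A : Matrix (Fin p) (Fin p) ℝ) :
    TriCoords p →ₗ[ℝ] TriCoords p where
  toFun x q := (A * triMat x) q.1.1 q.1.2
  map_add' x y := by
    have h : triMat (x + y) = triMat x + triMat y := by
      ext i j
      by_cases hij : j ≤ i <;> simp [triMat, hij]
    ext q
    simp [h, Matrix.mul_add]
  map_smul' c x := by
    have h : triMat (c • x) = c • triMat x := by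
      ext i j
      by_cases hij : j ≤ i <;> simp [triMat, hij]
    ext q
    simp [h]

lemma triMat_triMulLeft {p : ℕ} {A : Matrix (Fin p) (Fin p) ℝ} (hA : memTplus A)
    (x : TriCoords p) : triMat (triMulLeft A x) = A * triMat x := by
  ext i j
  by_cases hij : j ≤ i
  · simp [triMat, triMulLeft, hij]
  · have h0 : (A * triMat x) i j = 0 := by
      rw [Matrix.mul_apply]
      refine Finset.sum_eq_zero fun k _ => ?_
      by_cases hk : j ≤ k
      · rw [hA.1 i k (lt_of_lt_of_le (not_le.mp hij) hk), zero_mul]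
      · simp [triMat, hk]
    rw [h0]
    simp [triMat, hij]

lemma triMulLeft_diag {p : ℕ} {A : Matrix (Fin p) (Fin p) ℝ} (hA : memTplus A)
    (x : TriCoords p) (i : Fin p) :
    triMulLeft A x ⟨(i, i), le_rfl⟩ = A i i * x ⟨(i, i), le_rfl⟩ := by
  change (A * triMat x) i i = _
  rw [Matrix.mul_apply, Finset.sum_eq_single i]
  · simp [triMat]
  · intro k _ hk
    rcases lt_or_gt_of_ne hk with h | h
    · simp [triMat, not_le.mpr h]
    · rw [hA.1 i k h, zero_mul]
  · simp

lemma memTplus_triMat {p : ℕ} {x : TriCoords p} (hx : x ∈ triPos p) : memTplus (triMat x) :=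
  ⟨fun i j hij => by simp [triMat, not_le.mpr hij], fun i => by simpa [triMat] using hx i⟩

lemma prod_lowIdx_fst {p : ℕ} (f : Fin p → ℝ) :
    ∏ q : LowIdx p, f q.1.1 = ∏ i, f i ^ ((i : ℕ) + 1) := by
  rw [← Finset.prod_subtype (Finset.univ.filter fun q : Fin p × Fin p => q.2 ≤ q.1)
    (by simp) fun q => f q.1, Finset.prod_filter, Fintype.prod_prod_type]
  refine Finset.prod_congr rfl fun i _ => ?_
  rw [← Finset.prod_filter]
  dsimp only
  rw [Finset.prod_const]
  congr 1
  rw [← Fin.card_Iic]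
  congr 1
  ext j
  simp

lemma det_triMulLeft {p : ℕ} {A : Matrix (Fin p) (Fin p) ℝ} (hA : memTplus A) :
    LinearMap.det (triMulLeft A) = ∏ i, A i i ^ ((i : ℕ) + 1) := by
  have hM : ∀ q r : LowIdx p, LinearMap.toMatrix' (triMulLeft A) q r =
      if q.1.2 = r.1.2 then A q.1.1 r.1.1 else 0 := by
    rintro ⟨⟨i, j⟩, hij⟩ ⟨⟨k, l⟩, hkl⟩
    simp only [LinearMap.toMatrix'_apply]
    change (A * triMat (Pi.single ⟨(k, l), hkl⟩ 1)) i j = _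
    rw [Matrix.mul_apply, Finset.sum_eq_single k]
    · by_cases hjl : j = l
      · subst hjl
        simp_all [triMat]
      · simp [triMat, Pi.single_apply, hjl]
    · intro m _ hm
      simp [triMat, Pi.single_apply, hm]
    · simp
  rw [← LinearMap.det_toMatrix', Matrix.BlockTriangular.det_eq_prod_diag_of_injective
    (b := fun q : LowIdx p => OrderDual.toDual (toLex q.1))]
  · simp only [hM, if_true]
    exact prod_lowIdx_fst fun i => A i i
  · intro q r hqr
    rw [hM]
    rcases Prod.Lex.toLex_lt_toLex.mp (OrderDual.toDual_lt_toDual.mp hqr) with h | ⟨_, h⟩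
    · rw [hA.1 _ _ h, ite_self]
    · rw [if_neg h.ne]
  · intro q r h
    exact Subtype.ext (toLex.injective (OrderDual.toDual.injective h))

lemma det_triMulLeft_pos {p : ℕ} {A : Matrix (Fin p) (Fin p) ℝ} (hA : memTplus A) :
    0 < LinearMap.det (triMulLeft A) := by
  rw [det_triMulLeft hA]
  exact Finset.prod_pos fun i _ => pow_pos (hA.2 i) _

lemma triMulLeft_mem_triPos_iff {p : ℕ} {A : Matrix (Fin p) (Fin p) ℝ} (hA : memTplus A)
    (x : TriCoords p) : triMulLeft A x ∈ triPos p ↔ x ∈ triPos p :=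
  forall_congr' fun i => by rw [triMulLeft_diag hA, mul_pos_iff_of_pos_left (hA.2 i)]

lemma triMulLeft_bijective {p : ℕ} {A : Matrix (Fin p) (Fin p) ℝ} (hA : memTplus A) :
    Function.Bijective (triMulLeft A) :=
  (LinearMap.equivOfDetNeZero (triMulLeft A) (det_triMulLeft_pos hA).ne').bijective

lemma triMulLeft_image_triPos {p : ℕ} {A : Matrix (Fin p) (Fin p) ℝ} (hA : memTplus A) :
    triMulLeft A '' triPos p = triPos p := by
  have h : triMulLeft A ⁻¹' triPos p = triPos p :=
    Set.ext fun x => triMulLeft_mem_triPos_iff hA x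
  conv_lhs => rw [← h]
  exact Set.image_preimage_eq _ (triMulLeft_bijective hA).surjective

lemma det_mul_gammaDens_triMulLeft {p : ℕ} {A : Matrix (Fin p) (Fin p) ℝ} (hA : memTplus A)
    (x : TriCoords p) :
    ENNReal.ofReal |LinearMap.det (triMulLeft A)| * gammaDens (triMulLeft A x) =
      gammaDens x := by
  rw [abs_of_pos (det_triMulLeft_pos hA), det_triMulLeft hA,
    ENNReal.ofReal_prod_of_nonneg fun i _ => (pow_pos (hA.2 i) _).le, gammaDens, gammaDens,
    ← Finset.prod_mul_distrib]
  refine Finset.prod_congr rfl fun i _ => ?_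
  rw [← ENNReal.ofReal_mul (pow_pos (hA.2 i) _).le, triMulLeft_diag hA, mul_zpow, ← mul_assoc,
    zpow_neg (A i i)]
  norm_cast
  rw [mul_inv_cancel₀ (pow_pos (hA.2 i) _).ne', one_mul]

/-- `gammaDens` is the density of a left-invariant measure on the lower triangular group. -/
lemma lintegral_triPos_triMulLeft {p : ℕ} {A : Matrix (Fin p) (Fin p) ℝ} (hA : memTplus A)
    (g : TriCoords p → ℝ≥0∞) :
    ∫⁻ x in triPos p, g (triMulLeft A x) * gammaDens x =
      ∫⁻ z in triPos p, g z * gammaDens z := by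
  conv_rhs => rw [← triMulLeft_image_triPos hA]
  rw [lintegral_image_eq_lintegral_abs_det_fderiv_mul volume (measurableSet_triPos p)
    (f := triMulLeft A) (f' := fun _ => LinearMap.toContinuousLinearMap (triMulLeft A))
    (fun x _ => (LinearMap.toContinuousLinearMap (triMulLeft A)).hasFDerivAt.hasFDerivWithinAt)
    (triMulLeft_bijective hA).injective.injOn]
  refine lintegral_congr fun x => ?_
  change _ = ENNReal.ofReal |LinearMap.det (triMulLeft A)| *
    (g (triMulLeft A x) * gammaDens (triMulLeft A x))
  rw [mul_left_comm, det_mul_gammaDens_triMulLeft hA]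

/-- In the Wishart model, every measurable equivariant estimator (under the lower
triangular group) has risk constant in the parameter. -/
theorem wishart_equivariant_constant_risk
    (p n : ℕ) (hp : 1 ≤ p) (hn : p ≤ n)
    (L : Matrix (Fin p) (Fin p) ℝ → ℝ≥0∞) (hL : Measurable L)
    (δ : Matrix (Fin p) (Fin p) ℝ → Matrix (Fin p) (Fin p) ℝ) (hδm : Measurable δ)
    (hδpd : ∀ T, memTplus T → (δ T).PosDef)
    (hδeq : ∀ A T, memTplus A → memTplus T → δ (A * T) = A * δ T * Aᵀ)
    (Θ : Matrix (Fin p) (Fin p) ℝ) (hΘ : memTplus Θ) :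
    ∫⁻ x in triPos p,
        L (Θ * δ (triMat x) * Θᵀ) * ENNReal.ofReal (wishartDens p n Θ (triMat x)) *
          gammaDens x =
      ∫⁻ z in triPos p,
        L (δ (triMat z)) * ENNReal.ofReal (wishartDens p n 1 (triMat z)) * gammaDens z := by
  symm
  rw [← lintegral_triPos_triMulLeft hΘ]
  refine setLIntegral_congr_fun (measurableSet_triPos p) fun x hx => ?_
  simp only [triMat_triMulLeft hΘ, hδeq Θ _ hΘ (memTplus_triMat hx), wishartDens,
    Matrix.one_mul]
end
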